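/- (First- and second-order necessary optimality conditions under mixed initial/final constraints.) Let 0 < α ≤ 1, β > 0, and integers n, j ≥ 1. Let φ : ℝⁿ×ℝⁿ → ℝ and L : ℝⁿ×ℝⁿ×[a,b] → ℝ be of class C², let g : ℝⁿ×ℝⁿ → ℝ^j be of class C¹, and let S ⊂ ℝ^j be nonempty, closed and convex. For (u',y') ∈ L^∞([a,b],ℝⁿ)×ℝⁿ set x(t,u',y') := y' + ∫_a^t ((t−s)^{α−1}/Γ(α)) u'(s) ds and 𝓛(u',y') := φ(y', x(b,u',y')) + ∫_a^b ((b−s)^{β−1}/Γ(β)) L( x(s,u',y'), u'(s), s ) ds. Suppose (u,y) ∈ L^∞([a,b],ℝⁿ)×ℝⁿ, with x := x(·,u,y), satisfies g(x(a),x(b)) ∈ S, the differential Dg(x(a),x(b)) : ℝⁿ×ℝⁿ → ℝ^j is surjective, and 𝓛(u,y) ≤ 𝓛(u',y') for every (u',y') ∈ L^∞([a,b],ℝⁿ)×ℝⁿ with g(x(a,u',y'), x(b,u',y')) ∈ S. Write p̃(s) := ((b−s)^{β−1}/Γ(β)) ∂₂L(x(s),u(s),s). Then there exist ψ ∈ ℝ^j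 and an absolutely continuous function q : [a,b] → ℝⁿ such that: (0) ⟨−ψ, z − g(x(a),x(b))⟩ ≤ 0 for all z ∈ S (i.e. −ψ belongs to the normal cone to S at g(x(a),x(b))); (i) (Euler–Lagrange) q(t) = ∫_t^b ((s−t)^{−α}/Γ(1−α)) p̃(s) ds for almost every t ∈ [a,b] when α < 1 (and q(t) = p̃(t) for almost every t when α = 1), and q'(t) = ((b−t)^{β−1}/Γ(β)) ∂₁L(x(t),u(t),t) for almost every t ∈ [a,b]; (ii) (Transversality) q(a) = ∂₁φ(x(a),x(b)) − (∂₁g(x(a),x(b)))ᵀ ψ and −q(b) = ∂₂φ(x(a),x(b)) − (∂₂g(x(a),x(b)))ᵀ ψ; (iii) (Legendre) for almost every t ∈ [a,b] and all v ∈ ℝⁿ, vᵀ ((b−t)^{β−1}/Γ(β)) ∂²₂₂L(x(t),u(t),t) v ≥ 0. -/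

import Mathlib

open MeasureTheory Set
open scoped RealInnerProductSpace

/-- The trajectory `x(·,u,y)` associated with a Caputo fractional derivative `u`
of order `α` and initial condition `y`. -/
noncomputable def traj (n : ℕ) (a α : ℝ) (u : ℝ → EuclideanSpace ℝ (Fin n))
    (y : EuclideanSpace ℝ (Fin n)) (t : ℝ) : EuclideanSpace ℝ (Fin n) :=
  y + ∫ s in a..t, ((t - s) ^ (α - 1) / Real.Gamma α) • u s

/-- The Bolza functional. -/
noncomputable def bolza (n : ℕ) (a b α β : ℝ)
    (φ : EuclideanSpace ℝ (Fin n) × EuclideanSpace ℝ (Fin n) → ℝ)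
    (L : EuclideanSpace ℝ (Fin n) × EuclideanSpace ℝ (Fin n) × ℝ → ℝ)
    (u : ℝ → EuclideanSpace ℝ (Fin n)) (y : EuclideanSpace ℝ (Fin n)) : ℝ :=
  φ (y, traj n a α u y b) +
    ∫ s in a..b, ((b - s) ^ (β - 1) / Real.Gamma β) * L (traj n a α u y s, u s, s)

/-- Membership in `L^∞([a,b],ℝⁿ)` (a measurable, essentially bounded representative). -/
def admissible (n : ℕ) (a b : ℝ) (u : ℝ → EuclideanSpace ℝ (Fin n)) : Prop :=
  Measurable u ∧ ∃ C : ℝ, ∀ᵐ s ∂(volume : Measure ℝ), s ∈ Icc a b → ‖u s‖ ≤ C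

section PartA

/-- square wave -/
noncomputable def sqw (N : ℕ) (s : ℝ) : ℝ := if Even ⌊(N : ℝ) * s⌋ then 1 else -1

lemma sqw_cases (N : ℕ) (s : ℝ) : sqw N s = 1 ∨ sqw N s = -1 := by
  unfold sqw; split_ifs <;> simp

lemma sqw_abs (N : ℕ) (s : ℝ) : |sqw N s| = 1 := by
  rcases sqw_cases N s with h | h <;> simp [h]

lemma sqw_meas (N : ℕ) : Measurable (sqw N) := by
  unfold sqw
  have h : MeasurableSet {s : ℝ | Even ⌊(N : ℝ) * s⌋} := by
    have : Measurable (fun s : ℝ => ⌊(N : ℝ) * s⌋) := Int.measurable_floor.comp (measurable_const_mul _)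
    exact this (measurableSet_of_countable_int)
  exact Measurable.ite h measurable_const measurable_const
where measurableSet_of_countable_int : MeasurableSet {k : ℤ | Even k} := trivial

lemma sqw_shift (N : ℕ) (hN : N ≠ 0) (s : ℝ) : sqw N (s + 1 / N) = - sqw N s := by
  unfold sqw
  have hN' : (N : ℝ) ≠ 0 := by exact_mod_cast hN
  have : (N : ℝ) * (s + 1 / N) = N * s + 1 := by field_simp
  rw [this, Int.floor_add_one]
  by_cases h : Even ⌊(N : ℝ) * s⌋ <;> simp [h]

lemma sqw_integrable {f : ℝ → ℝ} (hf : Integrable f) (N : ℕ) :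
    Integrable (fun s => sqw N s * f s) := by
  refine hf.bdd_mul (c := 1) (sqw_meas N).aestronglyMeasurable ?_
  exact Filter.Eventually.of_forall fun s => by rw [Real.norm_eq_abs, sqw_abs]

lemma sqw_weak_cc {f : ℝ → ℝ} (hc : Continuous f) (hs : HasCompactSupport f) :
    Filter.Tendsto (fun N : ℕ => ∫ s, sqw N s * f s) Filter.atTop (nhds 0) := by
  have hfi : Integrable f := hc.integrable_of_hasCompactSupport hs
  obtain ⟨R, -, hR⟩ : ∃ R : ℝ, 0 < R ∧ ∀ x : ℝ, R ≤ ‖x‖ → f x = 0 := hs.exists_pos_le_norm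
  obtain ⟨M, hM⟩ := hs.exists_bound_of_continuous hc
  have key : ∀ N : ℕ, N ≠ 0 → ∫ s, sqw N s * f s = (1/2) * ∫ s, sqw N s * (f s - f (s + 1 / N)) := by
    intro N hN
    have h1 : ∫ s, sqw N s * f s = - ∫ s, sqw N s * f (s + 1 / N) := by
      rw [← integral_add_right_eq_self (fun s => sqw N s * f s) (1 / (N : ℝ)), ← integral_neg]
      congr 1; ext s; rw [sqw_shift N hN]; ring
    have h2 : ∫ s, sqw N s * (f s - f (s + 1 / N)) =
        (∫ s, sqw N s * f s) - ∫ s, sqw N s * f (s + 1 / N) := by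
      rw [← integral_sub (sqw_integrable hfi N) (sqw_integrable (hfi.comp_add_right _) N)]
      congr 1; ext s; ring
    rw [h2]; linarith
  have h3 : Filter.Tendsto (fun N : ℕ => ∫ s, sqw N s * (f s - f (s + 1 / N)))
      Filter.atTop (nhds (∫ s : ℝ, (0:ℝ))) := by
    refine tendsto_integral_of_dominated_convergence
      (fun s => (Icc (-(R+1)) (R+1)).indicator (fun _ => 2 * M) s) ?_ ?_ ?_ ?_
    · intro N
      exact (sqw_integrable (hfi.sub (hfi.comp_add_right _)) N).aestronglyMeasurable
    · rw [integrable_indicator_iff measurableSet_Icc]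
      exact (continuous_const.integrableOn_Icc)
    · intro N
      refine Filter.Eventually.of_forall fun s => ?_
      rw [norm_mul, Real.norm_eq_abs, sqw_abs, one_mul]
      by_cases hs' : s ∈ Icc (-(R+1)) (R+1)
      · rw [indicator_of_mem hs']
        have := norm_sub_le (f s) (f (s + 1 / N))
        linarith [hM s, hM (s + 1 / N)]
      · rw [indicator_of_notMem hs']
        have hs2 : R + 1 < |s| := by
          by_contra h; push Not at h; exact hs' (abs_le.mp h)
        have hN1 : |1 / (N : ℝ)| ≤ 1 := by
          rw [abs_of_nonneg (by positivity)]
          rcases Nat.eq_zero_or_pos N with h | h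
          · simp [h]
          · rw [div_le_one (by exact_mod_cast h)]; exact_mod_cast h
        have h5 : R ≤ ‖s + 1 / (N:ℝ)‖ := by
          rw [Real.norm_eq_abs]
          have := abs_sub_abs_le_abs_sub s (-(1 / (N:ℝ)))
          rw [abs_neg, sub_neg_eq_add] at this
          linarith
        rw [hR s (by rw [Real.norm_eq_abs]; linarith), hR _ h5]; simp
    · refine Filter.Eventually.of_forall fun s => ?_
      have h6 : Filter.Tendsto (fun N : ℕ => f s - f (s + 1 / (N:ℝ))) Filter.atTop (nhds 0) := by
        have h7 : Filter.Tendsto (fun N : ℕ => s + 1 / (N:ℝ)) Filter.atTop (nhds (s + 0)) :=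
          tendsto_const_nhds.add tendsto_one_div_atTop_nhds_zero_nat
        rw [add_zero] at h7
        have h8 := (hc.tendsto s).comp h7
        simpa using (tendsto_const_nhds (x := f s)).sub h8
      refine squeeze_zero_norm (a := fun N : ℕ => ‖f s - f (s + 1 / (N:ℝ))‖) (fun N => ?_)
        (by have := h6.norm; rwa [norm_zero] at this)
      rw [norm_mul, Real.norm_eq_abs (sqw N s), sqw_abs, one_mul]
  have h9 : Filter.Tendsto (fun N : ℕ => (1/2) * ∫ s, sqw N s * (f s - f (s + 1 / N)))
      Filter.atTop (nhds 0) := by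
    have := h3.const_mul (1/2)
    rwa [integral_zero, mul_zero] at this
  refine h9.congr' ?_
  filter_upwards [Filter.eventually_ne_atTop 0] with N hN
  exact (key N hN).symm

lemma sqw_weak {f : ℝ → ℝ} (hf : Integrable f) :
    Filter.Tendsto (fun N : ℕ => ∫ s, sqw N s * f s) Filter.atTop (nhds 0) := by
  rw [Metric.tendsto_atTop]
  intro ε hε
  obtain ⟨g, hgs, hg, hgc, hgi⟩ := hf.exists_hasCompactSupport_integral_sub_le (half_pos hε)
  obtain ⟨N0, hN0⟩ := Metric.tendsto_atTop.mp (sqw_weak_cc hgc hgs) (ε/2) (half_pos hε)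
  refine ⟨N0, fun N hN => ?_⟩
  have h1 := hN0 N hN
  rw [dist_zero_right] at h1 ⊢
  have h2 : ∫ s, sqw N s * f s = (∫ s, sqw N s * (f s - g s)) + ∫ s, sqw N s * g s := by
    have hi : Integrable (fun s => sqw N s * (f s - g s)) := sqw_integrable (hf.sub hgi) N
    rw [← integral_add hi (sqw_integrable hgi N)]
    congr 1; ext s; ring
  have h3 : ‖∫ s, sqw N s * (f s - g s)‖ ≤ ε / 2 := by
    refine (norm_integral_le_integral_norm _).trans (le_trans (le_of_eq ?_) hg)
    congr 1; ext s; rw [norm_mul, Real.norm_eq_abs (sqw N s), sqw_abs, one_mul]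
  rw [h2]
  exact (norm_add_le _ _).trans_lt (by linarith)

end PartA

section PartB

lemma rpow_ker_int {γ : ℝ} (hγ : 0 < γ) (c d t : ℝ) :
    IntervalIntegrable (fun s => (t - s) ^ (γ - 1)) volume c d := by
  have h := (intervalIntegral.intervalIntegrable_rpow' (a := t - c) (b := t - d) (r := γ - 1)
    (by linarith)).comp_sub_left t
  simpa using h

lemma rpow_ker_int' {γ : ℝ} (hγ : 0 < γ) (c d t : ℝ) :
    IntervalIntegrable (fun s => (s - t) ^ (γ - 1)) volume c d := by
  have h := (intervalIntegral.intervalIntegrable_rpow' (a := c - t) (b := d - t) (r := γ - 1)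
    (by linarith)).comp_sub_right t
  simpa using h

lemma rpow_ker_integral {γ : ℝ} (hγ : 0 < γ) (c t : ℝ) :
    ∫ s in c..t, (t - s) ^ (γ - 1) = (t - c) ^ γ / γ := by
  rw [intervalIntegral.integral_comp_sub_left (fun x => x ^ (γ - 1)) t,
    integral_rpow (Or.inl (by linarith))]
  simp [Real.zero_rpow hγ.ne']

lemma fub {E : Type*} [NormedAddCommGroup E] [NormedSpace ℝ E] [CompleteSpace E]
    {τ b γ : ℝ} (hγ : 0 < γ) (hτ : τ ≤ b) {f : ℝ → E} (hf : IntervalIntegrable f volume τ b) :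
    IntervalIntegrable (fun t => ∫ s in t..b, (s - t) ^ (γ - 1) • f s) volume τ b ∧
    ∫ t in τ..b, ∫ s in t..b, (s - t) ^ (γ - 1) • f s = ∫ s in τ..b, ((s - τ) ^ γ / γ) • f s := by
  set μ := volume.restrict (Ioc τ b) with hμ
  have hfi : Integrable f μ := by
    rw [intervalIntegrable_iff_integrableOn_Ioc_of_le hτ] at hf; exact hf
  let K : ℝ → ℝ → ℝ := fun t s => if t < s then (s - t) ^ (γ - 1) else 0
  have hKm : Measurable (Function.uncurry K) := by
    refine Measurable.ite (measurableSet_lt measurable_fst measurable_snd) ?_ measurable_const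
    fun_prop
  have hK0 : ∀ t s, 0 ≤ K t s := by
    intro t s; simp only [K]; split_ifs with h
    · exact Real.rpow_nonneg (by linarith) _
    · exact le_rfl
  have hKind : ∀ s, (fun t => K t s) = (Iio s).indicator (fun t => (s - t) ^ (γ - 1)) := by
    intro s; ext t; simp [K, indicator_apply]
  have hset : ∀ s ∈ Ioc τ b, Ioc τ b ∩ Iio s = Ioo τ s := by
    intro s hs; ext t; simp only [mem_inter_iff, mem_Ioc, mem_Iio, mem_Ioo]
    constructor
    · rintro ⟨⟨h1, h2⟩, h3⟩; exact ⟨h1, h3⟩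
    · rintro ⟨h1, h2⟩; exact ⟨⟨h1, by linarith [hs.2]⟩, h2⟩
  have hKi : ∀ s ∈ Ioc τ b, Integrable (fun t => K t s) μ := by
    intro s hs
    rw [hKind, integrable_indicator_iff measurableSet_Iio, IntegrableOn, hμ,
      Measure.restrict_restrict measurableSet_Iio, inter_comm, hset s hs]
    exact ((intervalIntegrable_iff_integrableOn_Ioo_of_le hs.1.le).1 (rpow_ker_int hγ τ s s))
  have hKI : ∀ s ∈ Ioc τ b, ∫ t, K t s ∂μ = (s - τ) ^ γ / γ := by
    intro s hs
    rw [hKind, integral_indicator measurableSet_Iio, hμ,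
      Measure.restrict_restrict measurableSet_Iio, inter_comm, hset s hs, ← integral_Ioc_eq_integral_Ioo,
      ← intervalIntegral.integral_of_le hs.1.le, rpow_ker_integral hγ]
  have hFm : AEStronglyMeasurable (Function.uncurry fun t s => K t s • f s) (μ.prod μ) :=
    hKm.aestronglyMeasurable.smul hfi.aestronglyMeasurable.comp_snd
  have hFi : Integrable (Function.uncurry fun t s => K t s • f s) (μ.prod μ) := by
    rw [integrable_prod_iff' hFm]
    constructor
    · refine (ae_restrict_mem measurableSet_Ioc).mono fun s hs => ?_
      exact (hKi s hs).smul_const (f s)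
    · have : (fun s => ∫ t, ‖Function.uncurry (fun t s => K t s • f s) (t, s)‖ ∂μ)
          =ᵐ[μ] fun s => ((s - τ) ^ γ / γ) * ‖f s‖ := by
        refine (ae_restrict_mem measurableSet_Ioc).mono fun s hs => ?_
        simp only [Function.uncurry, norm_smul, Real.norm_eq_abs, abs_of_nonneg (hK0 _ _)]
        rw [integral_mul_const, hKI s hs]
      rw [integrable_congr this]
      refine hfi.norm.bdd_mul (c := (b - τ) ^ γ / γ) ?_ ?_
      · exact (by fun_prop : Measurable fun s : ℝ => (s - τ) ^ γ / γ).aestronglyMeasurable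
      · refine (ae_restrict_mem measurableSet_Ioc).mono fun s hs => ?_
        have h0 : 0 ≤ s - τ := by linarith [hs.1]
        rw [Real.norm_of_nonneg (by positivity)]
        have h1 : s - τ ≤ b - τ := by linarith [hs.2]
        gcongr
  have hin : ∀ t ∈ Ioc τ b, ∫ s, K t s • f s ∂μ = ∫ s in t..b, (s - t) ^ (γ - 1) • f s := by
    intro t ht
    have h1 : (fun s => K t s • f s) = (Ioi t).indicator (fun s => (s - t) ^ (γ - 1) • f s) := by
      ext s; simp only [K, indicator_apply, mem_Ioi]; split_ifs <;> simp
    have h2 : Ioc τ b ∩ Ioi t = Ioc t b := by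
      ext s; simp only [mem_inter_iff, mem_Ioc, mem_Ioi]
      constructor
      · rintro ⟨⟨h1, h2⟩, h3⟩; exact ⟨h3, h2⟩
      · rintro ⟨h1, h2⟩; exact ⟨⟨by linarith [ht.1], h2⟩, h1⟩
    rw [h1, integral_indicator measurableSet_Ioi, hμ,
      Measure.restrict_restrict measurableSet_Ioi, inter_comm, h2,
      intervalIntegral.integral_of_le ht.2]
  constructor
  · rw [intervalIntegrable_iff_integrableOn_Ioc_of_le hτ]
    refine (integrable_congr ?_).1 hFi.integral_prod_left
    exact (ae_restrict_mem measurableSet_Ioc).mono fun t ht => hin t ht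
  · rw [intervalIntegral.integral_of_le hτ, intervalIntegral.integral_of_le hτ]
    rw [← setIntegral_congr_fun measurableSet_Ioc hin]
    change ∫ t, ∫ s, K t s • f s ∂μ ∂μ = _
    rw [integral_integral_swap hFi]
    refine setIntegral_congr_fun measurableSet_Ioc fun s hs => ?_
    rw [integral_smul_const, hKI s hs]

lemma beta_lem {α : ℝ} (h0 : 0 < α) (h1 : α ≤ 1) {τ t : ℝ} (ht : τ < t) :
    ∫ s in τ..t, (t - s) ^ (α - 1) * (s - τ) ^ (1 - α) =
      Real.Gamma α * Real.Gamma (2 - α) * (t - τ) := by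
  have hA : 0 < t - τ := by linarith
  have h := Complex.betaIntegral_scaled ((2 - α : ℝ) : ℂ) (α : ℂ) hA
  rw [Complex.betaIntegral_eq_Gamma_mul_div _ _ (by simp; linarith) (by simpa using h0)] at h
  have e1 : ∫ x in (0:ℝ)..(t - τ), (x : ℂ) ^ (((2 - α : ℝ) : ℂ) - 1) * (((t - τ : ℝ) : ℂ) - x) ^ ((α : ℂ) - 1)
      = ((∫ x in (0:ℝ)..(t - τ), x ^ (1 - α) * (t - τ - x) ^ (α - 1) : ℝ) : ℂ) := by
    rw [← intervalIntegral.integral_ofReal]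
    refine intervalIntegral.integral_congr fun x hx => ?_
    rw [uIcc_of_le hA.le] at hx
    rw [Complex.ofReal_mul, Complex.ofReal_cpow hx.1, Complex.ofReal_cpow (by linarith [hx.2])]
    push_cast
    congr 2
    ring
  rw [e1] at h
  have e2 : ((2 - α : ℝ) : ℂ) + (α : ℂ) = 2 := by push_cast; ring
  rw [e2, Complex.Gamma_ofReal, Complex.Gamma_ofReal] at h
  have e3 : Complex.Gamma 2 = 1 := by
    rw [show (2:ℂ) = ((1:ℕ):ℂ) + 1 by norm_num, Complex.Gamma_nat_eq_factorial]; simp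
  have e4 : ((2:ℂ) - 1) = 1 := by norm_num
  rw [e3, e4, Complex.cpow_one, div_one] at h
  have h' : ∫ x in (0:ℝ)..(t - τ), x ^ (1 - α) * (t - τ - x) ^ (α - 1) =
    (t - τ) * (Real.Gamma (2 - α) * Real.Gamma α) := by exact_mod_cast h
  have e5 := intervalIntegral.integral_comp_sub_right
    (fun x => x ^ (1 - α) * (t - τ - x) ^ (α - 1)) τ (a := τ) (b := t)
  rw [sub_self, h'] at e5
  rw [show Real.Gamma α * Real.Gamma (2 - α) * (t - τ) = (t - τ) * (Real.Gamma (2 - α) * Real.Gamma α) by ring, ← e5]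
  refine intervalIntegral.integral_congr fun s _ => ?_
  rw [show t - τ - (s - τ) = t - s by ring]; ring

end PartB

section PartC

abbrev EE (n : ℕ) := EuclideanSpace ℝ (Fin n)

noncomputable def frac (n : ℕ) (a α : ℝ) (v : ℝ → EE n) (t : ℝ) : EE n :=
  ∫ s in a..t, ((t - s) ^ (α - 1) / Real.Gamma α) • v s

lemma traj_eq (n : ℕ) (a α : ℝ) (u : ℝ → EE n) (y : EE n) (t : ℝ) :
    traj n a α u y t = y + frac n a α u t := rfl

noncomputable def kap (a α t : ℝ) : ℝ := (t - a) ^ α / α / Real.Gamma α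

lemma kap_pos {a α t : ℝ} (hα : 0 < α) (h : a < t) : 0 < kap a α t := by
  have := Real.Gamma_pos_of_pos hα
  have h2 : 0 < t - a := by linarith
  unfold kap; positivity

lemma kap_mono {a α t b : ℝ} (hα : 0 < α) (h : a ≤ t) (h' : t ≤ b) : kap a α t ≤ kap a α b := by
  have := Real.Gamma_pos_of_pos hα
  have h2 : 0 ≤ t - a := by linarith
  unfold kap; gcongr

lemma kap_nonneg {a α t : ℝ} (hα : 0 < α) (h : a ≤ t) : 0 ≤ kap a α t := by
  have := Real.Gamma_pos_of_pos hα
  have h2 : 0 ≤ t - a := by linarith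
  unfold kap; positivity

lemma kap_meas (a α : ℝ) : Measurable (kap a α) := by
  unfold kap; fun_prop

lemma adm_ae {n : ℕ} {a b : ℝ} {u : ℝ → EE n} (h : admissible n a b u) :
    ∃ C : ℝ, 0 ≤ C ∧ ∀ᵐ s ∂(volume.restrict (Ioc a b)), ‖u s‖ ≤ C := by
  obtain ⟨C, hC⟩ := h.2
  refine ⟨max C 0, le_max_right _ _, ?_⟩
  rw [ae_restrict_iff' measurableSet_Ioc]
  filter_upwards [hC] with s hs h
  exact (hs (Ioc_subset_Icc_self h)).trans (le_max_left _ _)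

lemma adm_of {n : ℕ} {a b : ℝ} {u : ℝ → EE n} (h : Measurable u) (C : ℝ) (hC : ∀ s ∈ Icc a b, ‖u s‖ ≤ C) :
    admissible n a b u := ⟨h, C, Filter.Eventually.of_forall hC⟩

lemma adm_add {n : ℕ} {a b : ℝ} {u v : ℝ → EE n} (hu : admissible n a b u) (hv : admissible n a b v) :
    admissible n a b (fun s => u s + v s) := by
  obtain ⟨C, hC⟩ := hu.2
  obtain ⟨D, hD⟩ := hv.2
  refine ⟨hu.1.add hv.1, C + D, ?_⟩
  filter_upwards [hC, hD] with s h1 h2 h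
  exact (norm_add_le _ _).trans (add_le_add (h1 h) (h2 h))

lemma adm_smul {n : ℕ} {a b : ℝ} {u : ℝ → EE n} (c : ℝ) (hu : admissible n a b u) :
    admissible n a b (fun s => c • u s) := by
  obtain ⟨C, hC⟩ := hu.2
  refine ⟨hu.1.const_smul c, |c| * C, ?_⟩
  filter_upwards [hC] with s h1 h
  rw [norm_smul, Real.norm_eq_abs]
  exact mul_le_mul_of_nonneg_left (h1 h) (abs_nonneg _)

lemma adm_const {n : ℕ} {a b : ℝ} (c : EE n) : admissible n a b (fun _ => c) :=
  adm_of measurable_const ‖c‖ fun _ _ => le_rfl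

section
variable {n : ℕ} {a b α : ℝ}

lemma frac_int (hα : 0 < α) {v : ℝ → EE n} (hv : admissible n a b v) {t : ℝ} (ht : t ∈ Icc a b) :
    IntervalIntegrable (fun s => ((t - s) ^ (α - 1) / Real.Gamma α) • v s) volume a t := by
  obtain ⟨C, hC0, hC⟩ := adm_ae hv
  rw [intervalIntegrable_iff_integrableOn_Ioc_of_le ht.1]
  have h1 : IntegrableOn (fun s => (t - s) ^ (α - 1) / Real.Gamma α) (Ioc a t) :=
    ((intervalIntegrable_iff_integrableOn_Ioc_of_le ht.1).1 (rpow_ker_int hα a t t)).div_const _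
  refine Integrable.smul_of_top_left h1 (memLp_top_of_bound ?_ C ?_)
  · exact hv.1.aestronglyMeasurable
  · exact ae_restrict_of_ae_restrict_of_subset (Ioc_subset_Ioc_right ht.2) hC

lemma frac_add (hα : 0 < α) {u v : ℝ → EE n} (hu : admissible n a b u) (hv : admissible n a b v)
    {t : ℝ} (ht : t ∈ Icc a b) :
    frac n a α (fun s => u s + v s) t = frac n a α u t + frac n a α v t := by
  unfold frac
  simp_rw [smul_add]
  exact intervalIntegral.integral_add (frac_int hα hu ht) (frac_int hα hv ht)

lemma frac_smul (c : ℝ) (u : ℝ → EE n) (t : ℝ) :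
    frac n a α (fun s => c • u s) t = c • frac n a α u t := by
  unfold frac
  rw [← intervalIntegral.integral_smul]
  congr 1; ext1 s; rw [smul_comm]

lemma ker_integral (hα : 0 < α) (t : ℝ) :
    ∫ s in a..t, ((t - s) ^ (α - 1) / Real.Gamma α) = kap a α t := by
  rw [intervalIntegral.integral_div, rpow_ker_integral hα, kap]

lemma frac_const (hα : 0 < α) (c : EE n) (t : ℝ) :
    frac n a α (fun _ => c) t = kap a α t • c := by
  unfold frac
  rw [intervalIntegral.integral_smul_const, ker_integral hα]

lemma frac_bound (hα : 0 < α) {v : ℝ → EE n} {C : ℝ} (hC0 : 0 ≤ C)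
    (hC : ∀ᵐ s ∂(volume.restrict (Ioc a b)), ‖v s‖ ≤ C) {t : ℝ} (ht : t ∈ Icc a b) :
    ‖frac n a α v t‖ ≤ kap a α b * C := by
  have hG := Real.Gamma_pos_of_pos hα
  have h1 : ‖frac n a α v t‖ ≤ ∫ s in a..t, ((t - s) ^ (α - 1) / Real.Gamma α) * C := by
    unfold frac
    refine intervalIntegral.norm_integral_le_of_norm_le ht.1 ?_ ?_
    · rw [ae_restrict_iff' measurableSet_Ioc] at hC
      filter_upwards [hC] with s hs h
      rw [norm_smul, Real.norm_of_nonneg]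
      · refine mul_le_mul_of_nonneg_left (hs ⟨h.1, h.2.trans ht.2⟩) ?_
        have := Real.rpow_nonneg (by linarith [h.2] : 0 ≤ t - s) (α - 1)
        positivity
      · have := Real.rpow_nonneg (by linarith [h.2] : 0 ≤ t - s) (α - 1)
        positivity
    · exact ((rpow_ker_int hα a t t).div_const _).mul_const _
  rw [intervalIntegral.integral_mul_const, ker_integral hα] at h1
  exact h1.trans (mul_le_mul_of_nonneg_right (kap_mono hα ht.1 ht.2) hC0)

lemma frac_meas (hα : 0 < α) {v : ℝ → EE n} (hv : Measurable v) :
    AEStronglyMeasurable (frac n a α v) (volume.restrict (Ioc a b)) := by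
  have h1 : StronglyMeasurable (fun p : ℝ × ℝ =>
      if a < p.2 ∧ p.2 ≤ p.1 then ((p.1 - p.2) ^ (α - 1) / Real.Gamma α) • v p.2 else 0) := by
    refine Measurable.stronglyMeasurable ?_
    refine Measurable.ite ?_ ?_ measurable_const
    · exact (measurableSet_lt measurable_const measurable_snd).inter
        (measurableSet_le measurable_snd measurable_fst)
    · exact (by fun_prop : Measurable fun p : ℝ × ℝ => (p.1 - p.2) ^ (α - 1) / Real.Gamma α).smul
        (hv.comp measurable_snd)
  have h2 := h1.integral_prod_right' (ν := (volume : Measure ℝ))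
  refine (h2.aestronglyMeasurable (μ := volume.restrict (Ioc a b))).congr ?_
  refine (ae_restrict_mem measurableSet_Ioc).mono fun t ht => ?_
  unfold frac
  rw [intervalIntegral.integral_of_le ht.1.le, ← integral_indicator measurableSet_Ioc]
  refine integral_congr_ae (Filter.Eventually.of_forall fun s => ?_)
  simp only [indicator_apply, mem_Ioc]

/-- test function -/
noncomputable def rho (α τ s : ℝ) : ℝ := if τ < s then (s - τ) ^ (1 - α) / Real.Gamma (2 - α) else 0

lemma rho_meas (α τ : ℝ) : Measurable (rho α τ) := by
  unfold rho
  exact Measurable.ite measurableSet_Ioi (by fun_prop) measurable_const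

lemma rho_adm (hα1 : α ≤ 1) (τ : ℝ) (e : EE n) :
    admissible n a b (fun s => rho α τ s • e) := by
  have hG : 0 < Real.Gamma (2 - α) := Real.Gamma_pos_of_pos (by linarith)
  refine adm_of ((rho_meas α τ).smul_const e) ((|b - τ|) ^ (1 - α) / Real.Gamma (2 - α) * ‖e‖) ?_
  intro s hs
  rw [norm_smul]
  refine mul_le_mul_of_nonneg_right ?_ (norm_nonneg _)
  unfold rho
  split_ifs with h
  · have h0 : 0 ≤ s - τ := by linarith
    rw [Real.norm_of_nonneg (by positivity)]
    have h1 : s - τ ≤ |b - τ| := le_trans (by linarith [hs.2]) (le_abs_self _)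
    have h2 : 0 ≤ 1 - α := by linarith
    gcongr
  · rw [norm_zero]; positivity

lemma frac_rho (hα : 0 < α) (hα1 : α ≤ 1) {τ : ℝ} (hτ : τ ∈ Icc a b) (e : EE n) {t : ℝ}
    (ht : t ∈ Icc a b) :
    frac n a α (fun s => rho α τ s • e) t = (max (t - τ) 0) • e := by
  have hG : 0 < Real.Gamma (2 - α) := Real.Gamma_pos_of_pos (by linarith)
  have hG' := Real.Gamma_pos_of_pos hα
  have e1 : frac n a α (fun s => rho α τ s • e) t
      = (∫ s in a..t, ((t - s) ^ (α - 1) / Real.Gamma α) * rho α τ s) • e := by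
    unfold frac
    simp_rw [smul_smul]
    rw [intervalIntegral.integral_smul_const]
  rw [e1]; congr 1
  rcases le_or_gt t τ with h | h
  · rw [max_eq_right (by linarith)]
    rw [intervalIntegral.integral_congr_ae (g := fun _ => (0:ℝ))]
    · simp
    · refine Filter.Eventually.of_forall fun s hs => ?_
      rw [uIoc_of_le ht.1] at hs
      simp only [rho]
      rw [if_neg (by linarith [hs.2]), mul_zero]
  · rw [max_eq_left (by linarith)]
    have hi : ∀ c d : ℝ, c ∈ Icc a t → d ∈ Icc a t → IntervalIntegrable
        (fun s => ((t - s) ^ (α - 1) / Real.Gamma α) * rho α τ s) volume c d := by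
      intro c d hc hd
      have : IntervalIntegrable
        (fun s => ((t - s) ^ (α - 1) / Real.Gamma α) * rho α τ s) volume a t := by
        rw [intervalIntegrable_iff_integrableOn_Ioc_of_le ht.1]
        have h1 : IntegrableOn (fun s => (t - s) ^ (α - 1) / Real.Gamma α) (Ioc a t) :=
          ((intervalIntegrable_iff_integrableOn_Ioc_of_le ht.1).1 (rpow_ker_int hα a t t)).div_const _
        refine Integrable.mul_bdd (c := (b - τ) ^ (1 - α) / Real.Gamma (2 - α)) h1
          (rho_meas α τ).aestronglyMeasurable ?_
        refine (ae_restrict_mem measurableSet_Ioc).mono fun s hs => ?_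
        have hb : 0 ≤ b - τ := by linarith [ht.2]
        unfold rho
        split_ifs with h
        · have h0 : 0 ≤ s - τ := by linarith
          rw [Real.norm_of_nonneg (by positivity)]
          have h1 : s - τ ≤ b - τ := by linarith [hs.2, ht.2]
          have h2 : 0 ≤ 1 - α := by linarith
          gcongr
        · rw [norm_zero]; positivity
      refine this.mono_set ?_
      rw [uIcc_of_le ht.1]
      exact uIcc_subset_Icc hc hd
    rw [← intervalIntegral.integral_add_adjacent_intervals
      (hi a τ ⟨le_rfl, ht.1⟩ ⟨hτ.1, h.le⟩) (hi τ t ⟨hτ.1, h.le⟩ ⟨ht.1, le_rfl⟩)]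
    have z1 : ∫ s in a..τ, ((t - s) ^ (α - 1) / Real.Gamma α) * rho α τ s = 0 := by
      rw [intervalIntegral.integral_congr_ae (g := fun _ => (0:ℝ))]
      · simp
      · refine Filter.Eventually.of_forall fun s hs => ?_
        rw [uIoc_of_le hτ.1] at hs
        simp only [rho]
        rw [if_neg (by linarith [hs.2]), mul_zero]
    have z2 : ∫ s in τ..t, ((t - s) ^ (α - 1) / Real.Gamma α) * rho α τ s =
        ∫ s in τ..t, (1 / (Real.Gamma α * Real.Gamma (2 - α))) *
          ((t - s) ^ (α - 1) * (s - τ) ^ (1 - α)) := by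
      refine intervalIntegral.integral_congr_ae (Filter.Eventually.of_forall fun s hs => ?_)
      rw [uIoc_of_le h.le] at hs
      simp only [rho]
      rw [if_pos hs.1]; field_simp
    rw [z1, z2, intervalIntegral.integral_const_mul, beta_lem hα hα1 h]
    field_simp; simp
end

end PartC

section PartF

lemma aesm_prod {X Y : Type*} [TopologicalSpace X] [TopologicalSpace Y] {μ : Measure ℝ}
    {f : ℝ → X} {g : ℝ → Y} (hf : AEStronglyMeasurable f μ) (hg : AEStronglyMeasurable g μ) :
    AEStronglyMeasurable (fun s => (f s, g s)) μ := hf.prodMk hg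

lemma diff_lem {P V : Type*} [NormedAddCommGroup P] [NormedSpace ℝ P]
    [NormedAddCommGroup V] [NormedSpace ℝ V] [ProperSpace V] {μ : Measure ℝ}
    {w : ℝ → ℝ} (hw : Integrable w μ) {Z : ℝ → V} (hZ : AEStronglyMeasurable Z μ) {R : ℝ}
    (hR : ∀ᵐ s ∂μ, ‖Z s‖ ≤ R) {M : ℝ → P →L[ℝ] V} (hM : AEStronglyMeasurable M μ) {K : ℝ}
    (hK0 : 0 ≤ K) (hK : ∀ᵐ s ∂μ, ‖M s‖ ≤ K) {L : V → ℝ} (hL : ContDiff ℝ 1 L) :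
    Integrable (fun s => w s • (fderiv ℝ L (Z s)).comp (M s)) μ ∧
    HasFDerivAt (fun p => ∫ s, w s * L (Z s + M s p) ∂μ)
      (∫ s, w s • (fderiv ℝ L (Z s)).comp (M s) ∂μ) 0 := by
  have hLd : Differentiable ℝ L := hL.differentiable (by norm_num)
  have hLc : Continuous (fderiv ℝ L) := hL.continuous_fderiv (by norm_num)
  have hcomp : IsCompact (Metric.closedBall (0:V) (R + K)) := isCompact_closedBall _ _
  obtain ⟨C, hC⟩ := hcomp.exists_bound_of_continuousOn hLc.continuousOn
  obtain ⟨C0, hC0⟩ := hcomp.exists_bound_of_continuousOn hL.continuous.continuousOn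
  have hmem : ∀ᵐ s ∂μ, ∀ p ∈ Metric.ball (0:P) 1, Z s + M s p ∈ Metric.closedBall (0:V) (R + K) := by
    filter_upwards [hR, hK] with s h1 h2 p hp
    rw [mem_closedBall_zero_iff]
    rw [mem_ball_zero_iff] at hp
    refine (norm_add_le _ _).trans (add_le_add h1 ?_)
    calc ‖M s p‖ ≤ ‖M s‖ * ‖p‖ := (M s).le_opNorm p
      _ ≤ K * 1 := mul_le_mul h2 hp.le (norm_nonneg _) hK0
      _ = K := mul_one _
  have hF'm : AEStronglyMeasurable (fun s => w s • (fderiv ℝ L (Z s)).comp (M s)) μ := by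
    have h1 : AEStronglyMeasurable (fun s => (fderiv ℝ L (Z s), M s)) μ :=
      (hLc.comp_aestronglyMeasurable hZ).prodMk hM
    have h2 : Continuous fun q : (V →L[ℝ] ℝ) × (P →L[ℝ] V) => q.1.comp q.2 :=
      isBoundedBilinearMap_comp.continuous
    exact hw.aestronglyMeasurable.smul (h2.comp_aestronglyMeasurable h1)
  have hbd : ∀ᵐ s ∂μ, ∀ p ∈ Metric.ball (0:P) 1,
      ‖w s • (fderiv ℝ L (Z s + M s p)).comp (M s)‖ ≤ ‖w s‖ * (C * K) := by
    filter_upwards [hmem, hK] with s h1 h2 p hp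
    rw [norm_smul]
    refine mul_le_mul_of_nonneg_left ?_ (norm_nonneg _)
    refine (ContinuousLinearMap.opNorm_comp_le _ _).trans ?_
    have h3 := hC _ (h1 p hp)
    exact mul_le_mul h3 h2 (norm_nonneg _) ((norm_nonneg _).trans h3)
  have hbi : Integrable (fun s => ‖w s‖ * (C * K)) μ := hw.norm.mul_const _
  have h0 : (0:P) ∈ Metric.ball (0:P) 1 := Metric.mem_ball_self one_pos
  constructor
  · refine hbi.mono' hF'm ?_
    filter_upwards [hbd] with s hs
    simpa using hs 0 h0
  · have key := hasFDerivAt_integral_of_dominated_of_fderiv_le (𝕜 := ℝ) (μ := μ)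
      (F := fun p s => w s * L (Z s + M s p))
      (F' := fun p s => w s • (fderiv ℝ L (Z s + M s p)).comp (M s)) (x₀ := (0:P))
      (bound := fun s => ‖w s‖ * (C * K)) (Metric.ball_mem_nhds (0:P) one_pos) ?_ ?_ ?_ hbd hbi ?_
    · simpa using key
    · refine Filter.Eventually.of_forall fun p => ?_
      refine hw.aestronglyMeasurable.mul (hL.continuous.comp_aestronglyMeasurable (hZ.add ?_))
      exact (ContinuousLinearMap.apply ℝ V p).continuous.comp_aestronglyMeasurable hM
    · refine hw.mul_bdd (c := C0) ?_ ?_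
      · refine hL.continuous.comp_aestronglyMeasurable (hZ.add ?_)
        exact (ContinuousLinearMap.apply ℝ V (0:P)).continuous.comp_aestronglyMeasurable hM
      · filter_upwards [hmem] with s hs using hC0 _ (hs 0 h0)
    · simpa using hF'm
    · refine Filter.Eventually.of_forall fun s p _ => ?_
      have h1 : HasFDerivAt (fun p => Z s + M s p) (M s) p := (M s).hasFDerivAt.const_add _
      exact ((hLd _).hasFDerivAt.comp p h1).const_mul (w s)

lemma mult_dir {X Y : Type*} [NormedAddCommGroup X] [NormedSpace ℝ X] 
    [NormedAddCommGroup Y] [NormedSpace ℝ Y] [FiniteDimensional ℝ Y] [CompleteSpace Y]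
    {F : X → ℝ} {F' : X →L[ℝ] ℝ} (hF : HasFDerivAt F F' 0) {G : X → Y} {G' : X →L[ℝ] Y}
    (hG : HasStrictFDerivAt G G' 0) (hs : Function.Surjective G') (S : Set Y)
    (hmin : ∀ x, G x ∈ S → F 0 ≤ F x) (d : X)
    (hd : ∀ ε : ℝ, 0 < ε → ε < 1 → G 0 + ε • G' d ∈ S) : 0 ≤ F' d := by
  obtain ⟨R0, hR0⟩ := (G' : X →ₗ[ℝ] Y).exists_rightInverse_of_surjective
    (LinearMap.range_eq_top.2 hs)
  let R : Y →L[ℝ] X := LinearMap.toContinuousLinearMap R0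
  have hR : ∀ z, G' (R z) = z := fun z => by
    have := congrArg (fun f => f z) hR0
    exact this
  let A : ℝ × Y →L[ℝ] X := (ContinuousLinearMap.fst ℝ ℝ Y).smulRight d +
    R.comp (ContinuousLinearMap.snd ℝ ℝ Y)
  have hA : ∀ p : ℝ × Y, A p = p.1 • d + R p.2 := fun p => by simp [A]
  let T : ℝ × Y → ℝ × Y := fun p => (p.1, G (A p) - p.1 • G' d)
  have hT : HasStrictFDerivAt T ((ContinuousLinearEquiv.refl ℝ (ℝ × Y) : ℝ × Y →L[ℝ] ℝ × Y)) (0 : ℝ × Y) := by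
    have h1 : HasStrictFDerivAt (fun p : ℝ × Y => G (A p)) (G'.comp A) 0 := by
      refine HasStrictFDerivAt.comp (0 : ℝ × Y) ?_ A.hasStrictFDerivAt
      rw [map_zero]; exact hG
    have h2 : HasStrictFDerivAt (fun p : ℝ × Y => p.1 • G' d)
        ((ContinuousLinearMap.fst ℝ ℝ Y).smulRight (G' d)) 0 :=
      ((ContinuousLinearMap.fst ℝ ℝ Y).smulRight (G' d)).hasStrictFDerivAt
    have h3 := (hasStrictFDerivAt_fst (𝕜 := ℝ) (E := ℝ) (F := Y) (p := 0)).prodMk (h1.sub h2)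
    convert! h3 using 1
    ext p <;> simp [hA, hR]
  have hTa : T 0 = (0, G 0) := by simp [T]
  have hli := hT.to_localInverse
  have hri := hT.eventually_right_inverse
  have hl0 := hT.localInverse_apply_image
  set I := hT.localInverse T _ 0 with hI
  rw [hTa] at hli hri hl0
  have hc : HasDerivAt (fun ε : ℝ => ((ε, G 0) : ℝ × Y)) (1, 0) 0 :=
    (hasDerivAt_id (0:ℝ)).prodMk (hasDerivAt_const _ _)
  have hγ : HasDerivAt (fun ε : ℝ => A (I (ε, G 0))) d 0 := by
    have h1 := (hli.hasFDerivAt.comp_hasDerivAt (0:ℝ) hc)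
    have h2 := A.hasFDerivAt.comp_hasDerivAt (0:ℝ) h1
    convert! h2 using 1
    simp [hA]
  have hγ0 : A (I (0, G 0)) = 0 := by rw [hl0, map_zero]
  have hFγ : HasDerivAt (fun ε : ℝ => F (A (I (ε, G 0)))) (F' d) 0 := by
    have := (show HasFDerivAt F F' (A (I (0, G 0))) by rw [hγ0]; exact hF).comp_hasDerivAt (0:ℝ) hγ
    exact this
  have hev : ∀ᶠ ε in nhds (0:ℝ), T (I (ε, G 0)) = (ε, G 0) := hc.continuousAt.eventually hri
  have hsl := hFγ.tendsto_slope_zero_right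
  refine ge_of_tendsto hsl ?_
  have h1 : ∀ᶠ ε in nhdsWithin (0:ℝ) (Ioi 0), ε ∈ Ioo (0:ℝ) 1 := Ioo_mem_nhdsGT one_pos
  filter_upwards [h1, nhdsWithin_le_nhds hev] with ε hε hTε
  have h2 : (I (ε, G 0)).1 = ε := congrArg Prod.fst hTε
  have h3 : G (A (I (ε, G 0))) - (I (ε, G 0)).1 • G' d = G 0 := congrArg Prod.snd hTε
  rw [h2, sub_eq_iff_eq_add] at h3
  have h4 := hmin (A (I (ε, G 0))) (by rw [h3]; exact hd ε hε.1 hε.2)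
  rw [zero_add, hγ0, smul_eq_mul]
  exact mul_nonneg (inv_nonneg.2 hε.1.le) (by linarith)

lemma mult_lem {X : Type*} {j : ℕ} [NormedAddCommGroup X] [NormedSpace ℝ X] 
    {F : X → ℝ} {F' : X →L[ℝ] ℝ} (hF : HasFDerivAt F F' 0) {G : X → EuclideanSpace ℝ (Fin j)}
    {G' : X →L[ℝ] EuclideanSpace ℝ (Fin j)}
    (hG : HasStrictFDerivAt G G' 0) (hs : Function.Surjective G') {S : Set (EuclideanSpace ℝ (Fin j))}
    (hS : Convex ℝ S) (h0 : G 0 ∈ S)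
    (hmin : ∀ x, G x ∈ S → F 0 ≤ F x) :
    ∃ ψ : EuclideanSpace ℝ (Fin j), (∀ x, F' x = ⟪ψ, G' x⟫) ∧ ∀ z ∈ S, 0 ≤ ⟪ψ, z - G 0⟫ := by
  have hker : ∀ d, G' d = 0 → F' d = 0 := by
    intro d hd
    have h1 := mult_dir hF hG hs S hmin d (fun ε _ _ => by rw [hd]; simpa using h0)
    have h2 := mult_dir hF hG hs S hmin (-d) (fun ε _ _ => by rw [map_neg, hd]; simpa using h0)
    rw [map_neg] at h2; linarith
  obtain ⟨R0, hR0⟩ := (G' : X →ₗ[ℝ] EuclideanSpace ℝ (Fin j)).exists_rightInverse_of_surjective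
    (LinearMap.range_eq_top.2 hs)
  have hR : ∀ z, G' (R0 z) = z := fun z => by
    have := congrArg (fun f => f z) hR0
    simpa using this
  let ℓ : EuclideanSpace ℝ (Fin j) →L[ℝ] ℝ := LinearMap.toContinuousLinearMap ((F' : X →ₗ[ℝ] ℝ).comp R0)
  have hℓ : ∀ z, ℓ z = F' (R0 z) := fun z => by simp [ℓ]
  have hfac : ∀ x, F' x = ℓ (G' x) := by
    intro x
    have := hker (x - R0 (G' x)) (by rw [map_sub, hR, sub_self])
    rw [map_sub] at this
    rw [hℓ]; linarith
  refine ⟨(InnerProductSpace.toDual ℝ _).symm ℓ, fun x => ?_, fun z hz => ?_⟩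
  · rw [InnerProductSpace.toDual_symm_apply, hfac]
  · rw [InnerProductSpace.toDual_symm_apply, hℓ]
    refine mult_dir hF hG hs S hmin _ fun ε h1 h2 => ?_
    rw [hR]
    exact hS.add_smul_sub_mem h0 hz ⟨h1.le, h2.le⟩

/-- second-order one-dimensional lemma -/
lemma second_lem {h h1 : ℝ → ℝ} {h2 : ℝ} (hd : ∀ ε, HasDerivAt h (h1 ε) ε) (hd2 : HasDerivAt h1 h2 0)
    (hpos : ∀ ε, 0 ≤ h ε + h (-ε) - 2 * h 0) : 0 ≤ h2 := by
  by_contra hneg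
  push Not at hneg
  let k : ℝ → ℝ := fun ε => -(h ε + h (-ε) - 2 * h 0)
  have hk : ∀ ε, HasDerivAt k (-(h1 ε - h1 (-ε))) ε := by
    intro ε
    have e1 : HasDerivAt (fun x => h (-x)) (-(h1 (-ε))) ε := by
      have := (hd (-ε)).comp ε (hasDerivAt_neg ε)
      simpa using! this
    have := (((hd ε).add e1).sub_const (2 * h 0)).neg
    simpa [sub_eq_add_neg] using! this
  have hdk : deriv k = fun ε => -(h1 ε - h1 (-ε)) := funext fun ε => (hk ε).deriv
  have hk2 : HasDerivAt (deriv k) (-(2 * h2)) 0 := by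
    rw [hdk]
    have e1 : HasDerivAt (fun x => h1 (-x)) (-h2) 0 := by
      have := (show HasDerivAt h1 h2 (-0) by simpa using hd2).comp (0:ℝ) (hasDerivAt_neg 0)
      simpa using! this
    have := (hd2.sub e1).neg
    convert! this using 1; ring
  have hmin := isLocalMin_of_deriv_deriv_pos (f := k) (x₀ := 0) (by rw [hk2.deriv]; linarith)
    (by rw [hdk]; simp) (hk 0).continuousAt
  have hz : k =ᶠ[nhds 0] fun _ => 0 := by
    filter_upwards [hmin] with ε hε
    have e0 : k 0 = 0 := by simp only [k, neg_zero]; ring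
    rw [e0] at hε
    have : k ε ≤ 0 := by have := hpos ε; simp only [k]; linarith
    linarith
  have e2 := hz.deriv.deriv_eq
  rw [hk2.deriv] at e2
  simp at e2
  linarith

end PartF

section PartG

lemma sqw_weak_on {f : ℝ → ℝ} {c d : ℝ} (hf : Integrable f (volume.restrict (Ioc c d))) :
    Filter.Tendsto (fun N : ℕ => ∫ s in Ioc c d, sqw N s * f s) Filter.atTop (nhds 0) := by
  have h1 := sqw_weak ((integrable_indicator_iff measurableSet_Ioc).2 hf)
  refine h1.congr fun N => ?_
  rw [← integral_indicator measurableSet_Ioc]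
  congr 1; ext s
  simp only [indicator_apply]; split_ifs <;> simp

noncomputable def wgt (b β s : ℝ) : ℝ := (b - s) ^ (β - 1) / Real.Gamma β

lemma wgt_int {a b β : ℝ} (hab : a < b) (hβ : 0 < β) :
    Integrable (wgt b β) (volume.restrict (Ioc a b)) :=
  ((intervalIntegrable_iff_integrableOn_Ioc_of_le hab.le).1 (rpow_ker_int hβ a b b)).div_const _

lemma bdd_mul_int {V : Type*} [NormedAddCommGroup V] [NormedSpace ℝ V] [ProperSpace V]
    {μ : Measure ℝ} {w : ℝ → ℝ} (hw : Integrable w μ) {Z : ℝ → V} (hZ : AEStronglyMeasurable Z μ) {R : ℝ}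
    (hR : ∀ᵐ s ∂μ, ‖Z s‖ ≤ R) {L : V → ℝ} (hL : Continuous L) :
    Integrable (fun s => w s * L (Z s)) μ := by
  obtain ⟨C0, hC0⟩ := (isCompact_closedBall (0:V) R).exists_bound_of_continuousOn hL.continuousOn
  refine hw.mul_bdd (c := C0) (hL.comp_aestronglyMeasurable hZ) ?_
  filter_upwards [hR] with s hs
  exact hC0 _ (by simpa using hs)

section
variable {n : ℕ} {a b α β : ℝ}

lemma traj_meas (hα : 0 < α) {u : ℝ → EE n} (hu : admissible n a b u) (y : EE n) :
    AEStronglyMeasurable (traj n a α u y) (volume.restrict (Ioc a b)) :=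
  (frac_meas hα hu.1).const_add y

lemma traj_bdd (hα : 0 < α) {u : ℝ → EE n} (hu : admissible n a b u) (y : EE n) :
    ∃ R, 0 ≤ R ∧ ∀ t ∈ Icc a b, ‖traj n a α u y t‖ ≤ R := by
  obtain ⟨C, h0, hC⟩ := adm_ae hu
  refine ⟨max (‖y‖ + kap a α b * C) 0, le_max_right _ _, fun t ht => le_trans ?_ (le_max_left _ _)⟩
  rw [traj_eq]
  exact (norm_add_le _ _).trans (add_le_add le_rfl (frac_bound hα h0 hC ht))

lemma time_aesm {μ : Measure ℝ} : AEStronglyMeasurable (fun s : ℝ => s) μ :=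
  measurable_id.aestronglyMeasurable

lemma triple_bd {n : ℕ} {X U : EE n} {s a b R1 R2 R : ℝ} (hX : ‖X‖ ≤ R1) (hU : ‖U‖ ≤ R2) (hs : s ∈ Ioc a b)
    (h1 : R1 ≤ R) (h2 : R2 ≤ R) (h3 : |a| ≤ R) (h4 : |b| ≤ R) : ‖(X, U, s)‖ ≤ R := by
  rw [Prod.norm_mk, Prod.norm_mk]
  refine max_le (hX.trans h1) (max_le (hU.trans h2) ?_)
  rw [Real.norm_eq_abs, abs_le]
  have := neg_abs_le a; have := le_abs_self b
  constructor <;> linarith [hs.1, hs.2]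

lemma leg_int (hab : a < b) (hα : 0 < α) (hβ : 0 < β)
    {L : EE n × EE n × ℝ → ℝ} (hL : Continuous L) {u : ℝ → EE n} {y : EE n}
    (hu : admissible n a b u)
    (hfix : ∀ u' : ℝ → EE n, admissible n a b u' → traj n a α u' y b = traj n a α u y b →
      ∫ s in Ioc a b, wgt b β s * L (traj n a α u y s, u s, s) ≤
      ∫ s in Ioc a b, wgt b β s * L (traj n a α u' y s, u' s, s)) (v : EE n) :
    ∀ᵐ s ∂(volume.restrict (Ioc a b)), 0 ≤ wgt b β s * (1/2 * (L (traj n a α u y s, u s + v, s) +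
      L (traj n a α u y s, u s - v, s)) - L (traj n a α u y s, u s, s)) := by
  set μ := volume.restrict (Ioc a b) with hμ
  have hw := wgt_int (β := β) hab hβ
  obtain ⟨Rx, hRx0, hRx⟩ := traj_bdd (α := α) hα hu y
  obtain ⟨Ru, hRu0, hRu⟩ := adm_ae hu
  have hxm := traj_meas (α := α) hα hu y
  have hum : AEStronglyMeasurable u μ := hu.1.aestronglyMeasurable
  set x := traj n a α u y with hx
  have hκ : 0 < kap a α b := kap_pos hα hab
  set κ := kap a α b with hκd
  set R := Rx + 2 * κ * ‖v‖ + Ru + 2 * ‖v‖ + |a| + |b| with hRdef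
  have hv0 := norm_nonneg v
  have ha0 := abs_nonneg a
  have hb0 := abs_nonneg b
  have hκv : 0 ≤ 2 * κ * ‖v‖ := by positivity
  have hmemI : ∀ᵐ s ∂μ, s ∈ Ioc a b := ae_restrict_mem measurableSet_Ioc
  -- integrability for fixed shifts
  have hQ : ∀ z : EE n, ‖z‖ ≤ ‖v‖ → Integrable (fun s => wgt b β s * L (x s, u s + z, s)) μ := by
    intro z hz
    refine bdd_mul_int (Z := fun s => (x s, u s + z, s)) (R := R) hw
      (hxm.prodMk ((hum.add_const z).prodMk time_aesm)) ?_ hL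
    filter_upwards [hRu, hmemI] with s h1 h2
    refine triple_bd (hRx s ⟨h2.1.le, h2.2⟩) (R2 := Ru + ‖v‖)
      ((norm_add_le _ _).trans (add_le_add h1 hz)) h2 ?_ ?_ ?_ ?_ <;> linarith
  have hQ0 : Integrable (fun s => wgt b β s * L (x s, u s, s)) μ := by
    simpa using hQ 0 (by simp)
  have hQp := hQ v le_rfl
  have hQm : Integrable (fun s => wgt b β s * L (x s, u s - v, s)) μ := by
    simpa [sub_eq_add_neg] using hQ (-v) (by simp)
  have hg : Integrable (fun s => wgt b β s * (1/2 * (L (x s, u s + v, s) + L (x s, u s - v, s)) - L (x s, u s, s))) μ := by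
    have := ((hQp.add hQm).const_mul (1/2)).sub hQ0
    refine this.congr (Filter.Eventually.of_forall fun s => ?_)
    simp only [Pi.sub_apply, Pi.add_apply]; ring
  have hd : Integrable (fun s => wgt b β s * (1/2 * (L (x s, u s + v, s) - L (x s, u s - v, s)))) μ := by
    have := ((hQp.sub hQm).const_mul (1/2))
    refine this.congr (Filter.Eventually.of_forall fun s => ?_)
    simp only [Pi.sub_apply]; ring
  refine ae_nonneg_of_forall_setIntegral_nonneg hg fun A hA _ => ?_
  -- oscillating perturbations
  let hN : ℕ → ℝ → ℝ := fun N s => sqw N s * A.indicator (fun _ => (1:ℝ)) s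
  have hNm : ∀ N, Measurable (hN N) := fun N =>
    (sqw_meas N).mul (measurable_const.indicator hA)
  have hNb : ∀ N s, |hN N s| ≤ 1 := by
    intro N s
    simp only [hN]
    rw [abs_mul, sqw_abs, one_mul]
    by_cases h : s ∈ A <;> simp [h]
  let V : ℕ → ℝ → EE n := fun N s => hN N s • v
  have hVb : ∀ N s, ‖V N s‖ ≤ ‖v‖ := by
    intro N s; simp only [V]; rw [norm_smul, Real.norm_eq_abs]
    exact mul_le_of_le_one_left hv0 (hNb N s)
  have hVadm : ∀ N, admissible n a b (V N) := fun N =>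
    adm_of ((hNm N).smul_const v) ‖v‖ fun s _ => hVb N s
  have hfV : ∀ t ∈ Icc a b, Filter.Tendsto (fun N => frac n a α (V N) t) Filter.atTop (nhds 0) := by
    intro t ht
    have hk : Integrable (fun s => ((t - s) ^ (α - 1) / Real.Gamma α) * A.indicator (fun _ => (1:ℝ)) s)
        (volume.restrict (Ioc a t)) := by
      have h1 : Integrable (fun s => (t - s) ^ (α - 1) / Real.Gamma α) (volume.restrict (Ioc a t)) :=
        ((intervalIntegrable_iff_integrableOn_Ioc_of_le ht.1).1 (rpow_ker_int hα a t t)).div_const _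
      refine h1.mul_bdd (c := 1) (measurable_const.indicator hA).aestronglyMeasurable ?_
      refine Filter.Eventually.of_forall fun s => ?_
      by_cases h : s ∈ A <;> simp [h]
    have h2 := (sqw_weak_on hk).smul_const v
    rw [zero_smul] at h2
    refine h2.congr fun N => ?_
    unfold frac
    rw [intervalIntegral.integral_of_le ht.1, ← integral_smul_const]
    congr 1; ext1 s
    simp only [V, hN, smul_smul]
    congr 1; ring
  let c : ℕ → EE n := fun N => -(κ⁻¹ • frac n a α (V N) b)
  have hbI : b ∈ Icc a b := ⟨hab.le, le_rfl⟩
  have hc : Filter.Tendsto c Filter.atTop (nhds 0) := by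
    have := ((hfV b hbI).const_smul κ⁻¹).neg
    simpa using this
  have hfVb : ∀ N, ∀ t ∈ Icc a b, ‖frac n a α (V N) t‖ ≤ κ * ‖v‖ := fun N t ht =>
    frac_bound hα hv0 (Filter.Eventually.of_forall (hVb N)) ht
  have hcb : ∀ N, ‖c N‖ ≤ ‖v‖ := by
    intro N
    simp only [c]
    rw [norm_neg, norm_smul, Real.norm_of_nonneg (by positivity)]
    calc κ⁻¹ * ‖frac n a α (V N) b‖ ≤ κ⁻¹ * (κ * ‖v‖) :=
          mul_le_mul_of_nonneg_left (hfVb N b hbI) (by positivity)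
      _ = ‖v‖ := by field_simp
  let δ : ℕ → ℝ → EE n := fun N t => frac n a α (V N) t + kap a α t • c N
  have hδ : ∀ t ∈ Icc a b, Filter.Tendsto (fun N => δ N t) Filter.atTop (nhds 0) := by
    intro t ht
    have := (hfV t ht).add (hc.const_smul (kap a α t))
    simpa using this
  have hδb : ∀ N, ∀ t ∈ Icc a b, ‖δ N t‖ ≤ 2 * κ * ‖v‖ := by
    intro N t ht
    have h1 : ‖kap a α t • c N‖ ≤ κ * ‖v‖ := by
      rw [norm_smul, Real.norm_of_nonneg (kap_nonneg hα ht.1)]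
      exact mul_le_mul (kap_mono hα ht.1 ht.2) (hcb N) (norm_nonneg _) hκ.le
    have := (norm_add_le (frac n a α (V N) t) (kap a α t • c N)).trans (add_le_add (hfVb N t ht) h1)
    simp only [δ]; linarith
  have hδm : ∀ N, AEStronglyMeasurable (δ N) μ := fun N =>
    (frac_meas hα (hVadm N).1).add ((kap_meas a α).aestronglyMeasurable.smul_const _)
  let uN : ℕ → ℝ → EE n := fun N s => u s + (V N s + c N)
  have huN : ∀ N, admissible n a b (uN N) := fun N => adm_add hu (adm_add (hVadm N) (adm_const (c N)))
  have htr : ∀ N, ∀ t ∈ Icc a b, traj n a α (uN N) y t = x t + δ N t := by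
    intro N t ht
    rw [hx, traj_eq, traj_eq, frac_add hα hu (adm_add (hVadm N) (adm_const (c N))) ht,
      frac_add hα (hVadm N) (adm_const (c N)) ht, frac_const hα, ← add_assoc]
  have htrb : ∀ N, traj n a α (uN N) y b = x b := by
    intro N
    rw [htr N b hbI]
    simp only [δ, c]
    rw [← hκd, smul_neg, smul_smul, mul_inv_cancel₀ hκ.ne', one_smul, add_neg_cancel, add_zero]
  have hineq := fun N => hfix (uN N) (huN N) (htrb N)
  -- error term
  let e : ℕ → ℝ → ℝ := fun N s => wgt b β s *
    (L (x s + δ N s, u s + (V N s + c N), s) - L (x s, u s + V N s, s))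
  have hVm : ∀ N, AEStronglyMeasurable (V N) μ := fun N => (hVadm N).1.aestronglyMeasurable
  have hball1 : ∀ N, ∀ᵐ s ∂μ, ‖((x s + δ N s, u s + (V N s + c N), s) : EE n × EE n × ℝ)‖ ≤ R := by
    intro N
    filter_upwards [hRu, hmemI] with s h1 h2
    have h2' : s ∈ Icc a b := ⟨h2.1.le, h2.2⟩
    refine triple_bd (R1 := Rx + 2 * κ * ‖v‖) (R2 := Ru + (‖v‖ + ‖v‖))
      ((norm_add_le _ _).trans (add_le_add (hRx s h2') (hδb N s h2')))
      ((norm_add_le _ _).trans (add_le_add h1 ((norm_add_le _ _).trans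
        (add_le_add (hVb N s) (hcb N))))) h2 ?_ ?_ ?_ ?_ <;> linarith
  have hball2 : ∀ N, ∀ᵐ s ∂μ, ‖((x s, u s + V N s, s) : EE n × EE n × ℝ)‖ ≤ R := by
    intro N
    filter_upwards [hRu, hmemI] with s h1 h2
    have h2' : s ∈ Icc a b := ⟨h2.1.le, h2.2⟩
    refine triple_bd (R2 := Ru + ‖v‖) (hRx s h2')
      ((norm_add_le _ _).trans (add_le_add h1 (hVb N s))) h2 ?_ ?_ ?_ ?_ <;> linarith
  have hi1 : ∀ N, Integrable (fun s => wgt b β s * L (x s + δ N s, u s + (V N s + c N), s)) μ := fun N =>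
    bdd_mul_int (Z := fun s => (x s + δ N s, u s + (V N s + c N), s)) hw
      ((hxm.add (hδm N)).prodMk ((hum.add ((hVm N).add_const (c N))).prodMk time_aesm)) (hball1 N) hL
  have hi2 : ∀ N, Integrable (fun s => wgt b β s * L (x s, u s + V N s, s)) μ := fun N =>
    bdd_mul_int (Z := fun s => (x s, u s + V N s, s)) hw
      (hxm.prodMk ((hum.add (hVm N)).prodMk time_aesm)) (hball2 N) hL
  have hie : ∀ N, Integrable (e N) μ := fun N => by
    refine ((hi1 N).sub (hi2 N)).congr (Filter.Eventually.of_forall fun s => ?_)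
    simp only [e, Pi.sub_apply]; ring
  obtain ⟨C0, hC0⟩ := (isCompact_closedBall (0 : EE n × EE n × ℝ) R).exists_bound_of_continuousOn
    hL.continuousOn
  have he : Filter.Tendsto (fun N => ∫ s, e N s ∂μ) Filter.atTop (nhds 0) := by
    have := tendsto_integral_of_dominated_convergence (μ := μ) (F := e) (f := fun _ => (0:ℝ))
      (fun s => ‖wgt b β s‖ * (C0 + C0)) (fun N => (hie N).aestronglyMeasurable)
      (hw.norm.mul_const _) ?_ ?_
    · simpa using this
    · intro N
      filter_upwards [hball1 N, hball2 N] with s h1 h2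
      simp only [e]
      rw [norm_mul]
      refine mul_le_mul_of_nonneg_left ?_ (norm_nonneg _)
      exact (norm_sub_le _ _).trans (add_le_add (hC0 _ (by simpa using h1)) (hC0 _ (by simpa using h2)))
    · filter_upwards [hmemI] with s h2
      have h2' : s ∈ Icc a b := ⟨h2.1.le, h2.2⟩
      let D : EE n → ℕ → ℝ := fun z N => ‖L (x s + δ N s, u s + (z + c N), s) - L (x s, u s + z, s)‖
      have hD : ∀ z, Filter.Tendsto (D z) Filter.atTop (nhds 0) := by
        intro z
        have t1 : Filter.Tendsto (fun N => ((x s + δ N s, u s + (z + c N), s) : EE n × EE n × ℝ))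
            Filter.atTop (nhds (x s + 0, u s + (z + 0), s)) :=
          ((hδ s h2').const_add _).prodMk_nhds
            (((hc.const_add z).const_add (u s)).prodMk_nhds tendsto_const_nhds)
        rw [add_zero, add_zero] at t1
        have t2 := ((hL.tendsto _).comp t1).sub_const (L (x s, u s + z, s))
        rw [sub_self] at t2
        simpa using! t2.norm
      have hsum : Filter.Tendsto (fun N => ‖wgt b β s‖ * (D 0 N + D v N + D (-v) N)) Filter.atTop (nhds 0) := by
        have := (((hD 0).add (hD v)).add (hD (-v))).const_mul ‖wgt b β s‖
        simpa using this
      refine squeeze_zero_norm (fun N => ?_) hsum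
      simp only [e]
      rw [norm_mul]
      refine mul_le_mul_of_nonneg_left ?_ (norm_nonneg _)
      have p0 : 0 ≤ D 0 N := norm_nonneg _
      have p1 : 0 ≤ D v N := norm_nonneg _
      have p2 : 0 ≤ D (-v) N := norm_nonneg _
      have hcase : V N s = 0 ∨ V N s = v ∨ V N s = -v := by
        simp only [V, hN]
        by_cases hs : s ∈ A
        · rcases sqw_cases N s with h | h <;> simp [hs, h]
        · simp [hs]
      rcases hcase with h | h | h
      · calc _ = D 0 N := by simp only [D]; rw [h]
          _ ≤ _ := by linarith
      · calc _ = D v N := by simp only [D]; rw [h]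
          _ ≤ _ := by linarith
      · calc _ = D (-v) N := by simp only [D]; rw [h]
          _ ≤ _ := by linarith
  have hdA : Integrable (fun s => A.indicator (fun s => wgt b β s *
      (1/2 * (L (x s, u s + v, s) - L (x s, u s - v, s)))) s) μ := hd.indicator hA
  have hosc := sqw_weak_on hdA
  have hgA := hg.indicator hA
  have hfin : ∀ N, 0 ≤ (∫ s, e N s ∂μ) + (∫ s in A, wgt b β s * (1/2 * (L (x s, u s + v, s) +
      L (x s, u s - v, s)) - L (x s, u s, s)) ∂μ) + ∫ s in Ioc a b, sqw N s *
      (A.indicator (fun s => wgt b β s * (1/2 * (L (x s, u s + v, s) - L (x s, u s - v, s)))) s) := by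
    intro N
    have hsq : Integrable (fun s => sqw N s * (A.indicator (fun s => wgt b β s *
      (1/2 * (L (x s, u s + v, s) - L (x s, u s - v, s)))) s)) μ := by
      refine hdA.bdd_mul (c := 1) (sqw_meas N).aestronglyMeasurable ?_
      exact Filter.Eventually.of_forall fun s => by rw [Real.norm_eq_abs, sqw_abs]
    have h1 := hineq N
    rw [← integral_indicator hA, ← integral_add (hie N) hgA]
    have hsum := integral_add ((hie N).add hgA) hsq
    simp only [Pi.add_apply] at hsum
    rw [← hsum]
    have h3 : ∫ s in Ioc a b, wgt b β s * L (traj n a α (uN N) y s, uN N s, s) =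
        ∫ s in Ioc a b, wgt b β s * L (x s + δ N s, u s + (V N s + c N), s) := by
      refine setIntegral_congr_fun measurableSet_Ioc fun s hs => ?_
      change wgt b β s * L (traj n a α (uN N) y s, uN N s, s) = _
      rw [htr N s ⟨hs.1.le, hs.2⟩]
    rw [h3, ← sub_nonneg, ← integral_sub (hi1 N) hQ0] at h1
    refine h1.trans (le_of_eq (integral_congr_ae (Filter.Eventually.of_forall fun s => ?_)))
    simp only [e]
    by_cases hs : s ∈ A
    · simp only [indicator_of_mem hs, V, hN]
      rcases sqw_cases N s with h | h
      · simp only [h, one_mul, one_smul]; ring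
      · simp only [h, mul_one, neg_smul, one_smul, ← sub_eq_add_neg]; ring
    · simp only [indicator_of_notMem hs, V, hN, mul_zero, zero_smul, add_zero]; ring
  have hlim := (he.add_const (∫ s in A, wgt b β s * (1/2 * (L (x s, u s + v, s) +
      L (x s, u s - v, s)) - L (x s, u s, s)) ∂μ)).add hosc
  have := ge_of_tendsto' hlim hfin
  simpa using this
end

end PartG

section PartH

lemma ae_eq_of_tails {E : Type*} [NormedAddCommGroup E] [NormedSpace ℝ E] [CompleteSpace E]
    {a b : ℝ} (hab : a < b) {f g : ℝ → E} (hf : IntervalIntegrable f volume a b)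
    (hg : IntervalIntegrable g volume a b)
    (h : ∀ τ ∈ Icc a b, ∫ t in τ..b, f t = ∫ t in τ..b, g t) :
    ∀ᵐ t ∂(volume.restrict (Icc a b)), f t = g t := by
  have hD : IntervalIntegrable (fun t => f t - g t) volume a b := hf.sub hg
  have h1 := hD.ae_hasDerivAt_integral
  have hz : ∀ x ∈ Icc a b, ∫ t in a..x, (f t - g t) = 0 := by
    intro x hx
    have hsub : uIcc x b ⊆ uIcc a b := by
      rw [uIcc_of_le hx.2, uIcc_of_le hab.le]; exact Icc_subset_Icc_left hx.1
    have hsub' : uIcc a x ⊆ uIcc a b := by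
      rw [uIcc_of_le hx.1, uIcc_of_le hab.le]; exact Icc_subset_Icc_right hx.2
    have e1 := intervalIntegral.integral_add_adjacent_intervals (hD.mono_set hsub') (hD.mono_set hsub)
    rw [intervalIntegral.integral_sub (hf.mono_set hsub) (hg.mono_set hsub), h x hx, sub_self,
      intervalIntegral.integral_sub hf hg, h a ⟨le_rfl, hab.le⟩, sub_self, add_zero] at e1
    exact e1
  rw [← Measure.restrict_congr_set Ioo_ae_eq_Icc, ae_restrict_iff' measurableSet_Ioo]
  filter_upwards [h1] with x hx hxI
  have hx' : x ∈ uIcc a b := by rw [uIcc_of_le hab.le]; exact Ioo_subset_Icc_self hxI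
  have h2 := hx hx' a left_mem_uIcc
  have h3 : HasDerivAt (fun x => ∫ t in a..x, (f t - g t)) 0 x := by
    refine (hasDerivAt_const x (0:E)).congr_of_eventuallyEq ?_
    filter_upwards [Ioo_mem_nhds hxI.1 hxI.2] with z hz'
    exact hz z (Ioo_subset_Icc_self hz')
  exact sub_eq_zero.1 (h2.unique h3)

lemma EL_lem {E : Type*} [NormedAddCommGroup E] [NormedSpace ℝ E] [CompleteSpace E]
    {a b α : ℝ} (hab : a < b) {r p : ℝ → E} (hr : IntervalIntegrable r volume a b)
    (hp : IntervalIntegrable p volume a b) {q : ℝ → E} (qa : E)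
    (hq : ∀ t, q t = qa + ∫ s in a..t, r s)
    (h : ∀ τ ∈ Icc a b, (∫ s in τ..b, (s - τ) • r s) +
      ∫ s in τ..b, ((s - τ) ^ (1 - α) / Real.Gamma (2 - α)) • p s = (b - τ) • q b) :
    (α < 1 → ∀ᵐ t ∂(volume.restrict (Icc a b)),
      q t = ∫ s in t..b, ((s - t) ^ (-α) / Real.Gamma (1 - α)) • p s) ∧
    (α = 1 → ∀ᵐ t ∂(volume.restrict (Icc a b)), q t = p t) := by
  have hsub : ∀ τ ∈ Icc a b, uIcc τ b ⊆ uIcc a b := by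
    intro τ hτ
    rw [uIcc_of_le hτ.2, uIcc_of_le hab.le]; exact Icc_subset_Icc_left hτ.1
  have hsub' : ∀ τ ∈ Icc a b, uIcc a τ ⊆ uIcc a b := by
    intro τ hτ
    rw [uIcc_of_le hτ.1, uIcc_of_le hab.le]; exact Icc_subset_Icc_right hτ.2
  have hq2 : ∀ t ∈ Icc a b, q t = q b - ∫ s in t..b, (s - t) ^ ((1:ℝ) - 1) • r s := by
    intro t ht
    have e1 := intervalIntegral.integral_add_adjacent_intervals (hr.mono_set (hsub' t ht)) (hr.mono_set (hsub t ht))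
    simp only [sub_self, Real.rpow_zero, one_smul]
    rw [hq, hq b, ← e1]; abel
  have hfr := fun τ (hτ : τ ∈ Icc a b) => fub (γ := 1) one_pos hτ.2 (hr.mono_set (hsub τ hτ))
  have hqi : IntervalIntegrable q volume a b := by
    have h1 : IntervalIntegrable (fun t => q b - ∫ s in t..b, (s - t) ^ ((1:ℝ) - 1) • r s) volume a b :=
      intervalIntegrable_const.sub (hfr a ⟨le_rfl, hab.le⟩).1
    rw [intervalIntegrable_iff_integrableOn_Ioc_of_le hab.le] at h1 ⊢
    exact h1.congr_fun (fun t ht => (hq2 t ⟨ht.1.le, ht.2⟩).symm) measurableSet_Ioc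
  have hqI : ∀ τ ∈ Icc a b, ∫ t in τ..b, q t =
      ∫ s in τ..b, ((s - τ) ^ (1 - α) / Real.Gamma (2 - α)) • p s := by
    intro τ hτ
    have e1 : ∫ t in τ..b, q t = ∫ t in τ..b, (q b - ∫ s in t..b, (s - t) ^ ((1:ℝ) - 1) • r s) := by
      refine intervalIntegral.integral_congr fun t ht => ?_
      rw [uIcc_of_le hτ.2] at ht
      exact hq2 t ⟨hτ.1.trans ht.1, ht.2⟩
    rw [e1, intervalIntegral.integral_sub intervalIntegrable_const (hfr τ hτ).1, (hfr τ hτ).2,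
      intervalIntegral.integral_const, ← h τ hτ]
    simp only [Real.rpow_one, div_one]
    abel
  constructor
  · intro hα
    have hγ : 0 < 1 - α := by linarith
    have hG : 0 < Real.Gamma (1 - α) := Real.Gamma_pos_of_pos hγ
    have hfp := fun τ (hτ : τ ∈ Icc a b) => fub (γ := 1 - α) hγ hτ.2 (hp.mono_set (hsub τ hτ))
    have e0 : (fun t => ∫ s in t..b, ((s - t) ^ (-α) / Real.Gamma (1 - α)) • p s) =
        fun t => (Real.Gamma (1 - α))⁻¹ • ∫ s in t..b, (s - t) ^ (1 - α - 1) • p s := by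
      ext1 t
      rw [← intervalIntegral.integral_smul]
      congr 1; ext1 s
      rw [smul_smul, show 1 - α - 1 = -α by ring]; congr 1; ring
    refine ae_eq_of_tails (g := fun t => ∫ s in t..b, ((s - t) ^ (-α) / Real.Gamma (1 - α)) • p s)
      hab hqi ?_ fun τ hτ => ?_
    · rw [e0]; exact (hfp a ⟨le_rfl, hab.le⟩).1.smul _
    · rw [e0, intervalIntegral.integral_smul, (hfp τ hτ).2, hqI τ hτ, ← intervalIntegral.integral_smul]
      congr 1; ext1 s
      rw [smul_smul]; congr 1
      have : Real.Gamma (2 - α) = (1 - α) * Real.Gamma (1 - α) := by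
        rw [← Real.Gamma_add_one hγ.ne']; congr 1; ring
      rw [this]; field_simp
  · intro hα
    subst hα
    refine ae_eq_of_tails hab hqi hp fun τ hτ => ?_
    rw [hqI τ hτ]
    have : Real.Gamma (2 - 1) = 1 := by norm_num
    simp [this]

section grads
variable {n : ℕ}

lemma grad1 {L : EE n × EE n × ℝ → ℝ} (hL : Differentiable ℝ L) (x u : EE n) (s : ℝ) (ξ : EE n) :
    ⟪gradient (fun z => L (z, u, s)) x, ξ⟫ = fderiv ℝ L (x, u, s) (ξ, 0, 0) := by
  have h1 : HasFDerivAt (fun z : EE n => (z, u, s)) (ContinuousLinearMap.inl ℝ (EE n) (EE n × ℝ)) x :=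
    hasFDerivAt_prodMk_left x (u, s)
  have h2 := (hL (x, u, s)).hasFDerivAt.comp x h1
  rw [inner_gradient_left]
  rw [show (fun z => L (z, u, s)) = L ∘ (fun z : EE n => (z, u, s)) from rfl, h2.fderiv]
  simp; rfl

lemma grad2 {L : EE n × EE n × ℝ → ℝ} (hL : Differentiable ℝ L) (x u : EE n) (s : ℝ) (ξ : EE n) :
    ⟪gradient (fun z => L (x, z, s)) u, ξ⟫ = fderiv ℝ L (x, u, s) (0, ξ, 0) := by
  have h1 : HasFDerivAt (fun z : EE n => (x, z, s))
      ((ContinuousLinearMap.inr ℝ (EE n) (EE n × ℝ)).comp (ContinuousLinearMap.inl ℝ (EE n) ℝ)) u :=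
    (hasFDerivAt_prodMk_right x (u, s)).comp u (hasFDerivAt_prodMk_left u s)
  have h2 := (hL (x, u, s)).hasFDerivAt.comp u h1
  rw [inner_gradient_left]
  rw [show (fun z => L (x, z, s)) = L ∘ (fun z : EE n => (x, z, s)) from rfl, h2.fderiv]
  simp

lemma gradL {L : EE n × EE n × ℝ → ℝ} (hL : Differentiable ℝ L) (x u : EE n) (s : ℝ) (ξ v : EE n) :
    fderiv ℝ L (x, u, s) (ξ, v, 0) = ⟪gradient (fun z => L (z, u, s)) x, ξ⟫ +
      ⟪gradient (fun z => L (x, z, s)) u, v⟫ := by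
  rw [grad1 hL, grad2 hL, ← map_add]; simp

lemma fder1 {F : Type*} [NormedAddCommGroup F] [NormedSpace ℝ F] {g : EE n × EE n → F}
    (hg : Differentiable ℝ g) (x z ξ : EE n) :
    fderiv ℝ (fun y => g (y, z)) x ξ = fderiv ℝ g (x, z) (ξ, 0) := by
  have h2 := (hg (x, z)).hasFDerivAt.comp x (hasFDerivAt_prodMk_left (𝕜 := ℝ) x z)
  rw [show (fun y => g (y, z)) = g ∘ (fun y : EE n => (y, z)) from rfl, h2.fderiv]
  simp

lemma fder2 {F : Type*} [NormedAddCommGroup F] [NormedSpace ℝ F] {g : EE n × EE n → F}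
    (hg : Differentiable ℝ g) (x z ξ : EE n) :
    fderiv ℝ (fun y => g (x, y)) z ξ = fderiv ℝ g (x, z) (0, ξ) := by
  have h2 := (hg (x, z)).hasFDerivAt.comp z (hasFDerivAt_prodMk_right (𝕜 := ℝ) x z)
  rw [show (fun y => g (x, y)) = g ∘ (fun y : EE n => (x, y)) from rfl, h2.fderiv]
  simp

lemma grad_int {μ : Measure ℝ} {w : ℝ → ℝ} (hw : Integrable w μ) {X U : ℝ → EE n} {L : EE n × EE n × ℝ → ℝ}
    (hL : ContDiff ℝ 1 L) (hZ : AEStronglyMeasurable (fun s => ((X s, U s, s) : EE n × EE n × ℝ)) μ)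
    {R : ℝ} (hR : ∀ᵐ s ∂μ, ‖((X s, U s, s) : EE n × EE n × ℝ)‖ ≤ R) :
    Integrable (fun s => w s • gradient (fun z => L (z, U s, s)) (X s)) μ ∧
    Integrable (fun s => w s • gradient (fun z => L (X s, z, s)) (U s)) μ := by
  have hLd : Differentiable ℝ L := hL.differentiable (by norm_num)
  have gen : ∀ (M : EE n →L[ℝ] EE n × EE n × ℝ) (gr : ℝ → EE n),
      (∀ s ξ, ⟪gr s, ξ⟫ = fderiv ℝ L (X s, U s, s) (M ξ)) → Integrable (fun s => w s • gr s) μ := by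
    intro M gr hgr
    obtain ⟨hi, -⟩ := diff_lem (M := fun _ => M) hw hZ hR aestronglyMeasurable_const (norm_nonneg M)
      (Filter.Eventually.of_forall fun _ => le_rfl) hL
    have he : (fun s => w s • gr s) = fun s => (InnerProductSpace.toDual ℝ (EE n)).symm
        (w s • (fderiv ℝ L (X s, U s, s)).comp M) := by
      ext1 s
      apply ext_inner_right ℝ
      intro ξ
      rw [InnerProductSpace.toDual_symm_apply, inner_smul_left, hgr]
      simp
    rw [he]
    refine hi.mono ((InnerProductSpace.toDual ℝ (EE n)).symm.continuous.comp_aestronglyMeasurable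
      hi.aestronglyMeasurable) (Filter.Eventually.of_forall fun s => ?_)
    rw [LinearIsometryEquiv.norm_map]
  constructor
  · exact gen (ContinuousLinearMap.inl ℝ (EE n) (EE n × ℝ)) _ fun s ξ => by
      rw [grad1 hLd]; simp; rfl
  · exact gen ((ContinuousLinearMap.inr ℝ (EE n) (EE n × ℝ)).comp (ContinuousLinearMap.inl ℝ (EE n) ℝ)) _
      fun s ξ => by rw [grad2 hLd]; simp

lemma leg_point {L : EE n × EE n × ℝ → ℝ} (hL : ContDiff ℝ 2 L) (x u : EE n) (t w : ℝ)
    (h : ∀ v : EE n, 0 ≤ w * (1/2 * (L (x, u + v, t) + L (x, u - v, t)) - L (x, u, t))) (v : EE n) :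
    0 ≤ w * ⟪v, (fderiv ℝ (fun z => gradient (fun z' => L (x, z', t)) z) u) v⟫ := by
  let f : EE n → ℝ := fun z => L (x, z, t)
  have hf : ContDiff ℝ 2 f := hL.comp (contDiff_const.prodMk (contDiff_id.prodMk contDiff_const))
  have hfd : Differentiable ℝ f := hf.differentiable (by norm_num)
  have hgd : Differentiable ℝ (fun z => gradient f z) := by
    have h1 : Differentiable ℝ (fderiv ℝ f) :=
      (hf.fderiv_right (m := 1) (by norm_num)).differentiable (by norm_num)
    let T : (EE n →L[ℝ] ℝ) →L[ℝ] EE n :=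
      { toFun := (InnerProductSpace.toDual ℝ (EE n)).symm
        map_add' := fun a b => map_add _ a b
        map_smul' := fun c a => by simp
        cont := (InnerProductSpace.toDual ℝ (EE n)).symm.continuous }
    exact T.differentiable.comp h1
  have hl : ∀ ε : ℝ, HasDerivAt (fun ε : ℝ => u + ε • v) v ε := by
    intro ε
    simpa using ((hasDerivAt_id ε).smul_const v).const_add u
  refine second_lem (h := fun ε => w * f (u + ε • v)) (h1 := fun ε => w * ⟪v, gradient f (u + ε • v)⟫)
    ?_ ?_ ?_
  · intro ε
    have h1 := ((hfd (u + ε • v)).hasFDerivAt.comp_hasDerivAt ε (hl ε)).const_mul w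
    rw [real_inner_comm, inner_gradient_left]
    exact h1
  · have h1 : HasFDerivAt (fun z => gradient f z) (fderiv ℝ (fun z => gradient f z) u) (u + (0:ℝ) • v) := by
      rw [zero_smul, add_zero]; exact (hgd u).hasFDerivAt
    have h2 := h1.comp_hasDerivAt (0:ℝ) (hl 0)
    have h3 := ((innerSL ℝ v).hasFDerivAt.comp_hasDerivAt (0:ℝ) h2).const_mul w
    exact h3
  · intro ε
    have := h (ε • v)
    simp only [f, neg_smul, ← sub_eq_add_neg, zero_smul, add_zero]
    linarith
end grads

end PartH

section PartI

lemma Z_lem {n : ℕ} {a b α : ℝ} (hα : 0 < α) {u : ℝ → EE n} (hu : admissible n a b u) (y : EE n) :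
    AEStronglyMeasurable (fun s => ((traj n a α u y s, u s, s) : EE n × EE n × ℝ)) (volume.restrict (Ioc a b)) ∧
    ∃ R : ℝ, ∀ᵐ s ∂(volume.restrict (Ioc a b)), ‖((traj n a α u y s, u s, s) : EE n × EE n × ℝ)‖ ≤ R := by
  refine ⟨(traj_meas hα hu y).prodMk (hu.1.aestronglyMeasurable.prodMk time_aesm), ?_⟩
  obtain ⟨R, hR0, hR⟩ := traj_bdd hα hu y
  obtain ⟨C, hC0, hC⟩ := adm_ae hu
  refine ⟨R + C + |a| + |b|, ?_⟩
  have h1 := abs_nonneg a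
  have h2 := abs_nonneg b
  filter_upwards [hC, ae_restrict_mem measurableSet_Ioc] with s hs hs'
  exact triple_bd (hR s ⟨hs'.1.le, hs'.2⟩) hs hs' (by linarith) (by linarith) (by linarith) (by linarith)

lemma fix_lem {n : ℕ} {a b α β : ℝ} (hab : a < b) (hα : 0 < α) (hβ : 0 < β)
    {L : EE n × EE n × ℝ → ℝ} (hL : ContDiff ℝ 1 L) {u : ℝ → EE n} {y : EE n}
    (hu : admissible n a b u)
    (hfix : ∀ u' : ℝ → EE n, admissible n a b u' → traj n a α u' y b = traj n a α u y b →
      ∫ s in Ioc a b, wgt b β s * L (traj n a α u y s, u s, s) ≤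
      ∫ s in Ioc a b, wgt b β s * L (traj n a α u' y s, u' s, s))
    {v : ℝ → EE n} (hv : admissible n a b v) (hvb : frac n a α v b = 0) :
    ∫ s in Ioc a b, (⟪wgt b β s • gradient (fun z => L (z, u s, s)) (traj n a α u y s), frac n a α v s⟫ +
      ⟪wgt b β s • gradient (fun z => L (traj n a α u y s, z, s)) (u s), v s⟫) = 0 := by
  obtain ⟨hZ, R, hR⟩ := Z_lem hα hu y
  obtain ⟨C, hC0, hC⟩ := adm_ae hv
  have hκ := kap_nonneg (a := a) hα hab.le
  set m : ℝ → EE n × EE n × ℝ := fun s => (frac n a α v s, v s, 0) with hm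
  have hmm : AEStronglyMeasurable m (volume.restrict (Ioc a b)) :=
    (frac_meas hα hv.1).prodMk (hv.1.aestronglyMeasurable.prodMk aestronglyMeasurable_const)
  have hmb : ∀ᵐ s ∂(volume.restrict (Ioc a b)), ‖m s‖ ≤ kap a α b * C + C := by
    filter_upwards [hC, ae_restrict_mem measurableSet_Ioc] with s hs hs'
    have := frac_bound hα hC0 hC (t := s) ⟨hs'.1.le, hs'.2⟩
    have h3 : 0 ≤ kap a α b * C := by positivity
    simp only [hm, Prod.norm_def, norm_zero]
    refine max_le (by linarith) (max_le (by linarith) (by linarith))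
  obtain ⟨h1, h2⟩ := diff_lem (wgt_int hab hβ) hZ hR
    (M := fun s => ContinuousLinearMap.toSpanSingleton ℝ (m s)) (K := kap a α b * C + C)
    ((ContinuousLinearMap.toSpanSingletonCLE (𝕜 := ℝ) (E := EE n × EE n × ℝ)).continuous.comp_aestronglyMeasurable hmm)
    (by positivity) (by
      filter_upwards [hmb] with s hs
      rwa [ContinuousLinearMap.norm_toSpanSingleton]) hL
  have hmin : IsLocalMin (fun p : ℝ => ∫ s in Ioc a b, wgt b β s * L ((traj n a α u y s, u s, s) +
      (ContinuousLinearMap.toSpanSingleton ℝ (m s)) p)) 0 := by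
    refine Filter.Eventually.of_forall fun ε => ?_
    have h3 := hfix (fun s => u s + ε • v s) (adm_add hu (adm_smul ε hv)) (by
      rw [traj_eq, traj_eq, frac_add hα hu (adm_smul ε hv) ⟨hab.le, le_rfl⟩, frac_smul, hvb]; simp)
    simp only [map_zero, add_zero]
    refine h3.trans (le_of_eq ?_)
    refine setIntegral_congr_fun measurableSet_Ioc fun s hs => ?_
    simp only [traj_eq, frac_add hα hu (adm_smul ε hv) ⟨hs.1.le, hs.2⟩, frac_smul]
    simp [hm, ContinuousLinearMap.toSpanSingleton_apply, add_assoc]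
  have h4 := hmin.hasFDerivAt_eq_zero h2
  have h5 := congrArg (fun T => T (1:ℝ)) h4
  simp only [ContinuousLinearMap.integral_apply h1] at h5
  rw [ContinuousLinearMap.zero_apply] at h5
  rw [← h5]
  refine setIntegral_congr_fun measurableSet_Ioc fun s hs => ?_
  simp [hm, gradL (hL.differentiable one_ne_zero), inner_smul_left, mul_add]

lemma mult_main {n j : ℕ} {a b α β : ℝ} (hab : a < b) (hα0 : 0 < α) (hβ : 0 < β)
    {φ : EE n × EE n → ℝ} {L : EE n × EE n × ℝ → ℝ} (hφ : ContDiff ℝ 1 φ) (hL : ContDiff ℝ 1 L)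
    {g : EE n × EE n → EE j} (hg : ContDiff ℝ 1 g) {S : Set (EE j)} (hSconv : Convex ℝ S)
    {u : ℝ → EE n} {y : EE n} (hadm : admissible n a b u)
    (hgS : g (y, traj n a α u y b) ∈ S)
    (hsurj : Function.Surjective (fderiv ℝ g (y, traj n a α u y b)))
    (hmin : ∀ u' : ℝ → EE n, ∀ y' : EE n,
      admissible n a b u' → g (y', traj n a α u' y' b) ∈ S →
      bolza n a b α β φ L u y ≤ bolza n a b α β φ L u' y') :
    ∃ ψ : EE j, (∀ z ∈ S, 0 ≤ ⟪ψ, z - g (y, traj n a α u y b)⟫) ∧ ∀ η c : EE n,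
      fderiv ℝ φ (y, traj n a α u y b) (η, η + kap a α b • c) +
      ∫ s in Ioc a b, (⟪wgt b β s • gradient (fun z => L (z, u s, s)) (traj n a α u y s), η + kap a α s • c⟫ +
      ⟪wgt b β s • gradient (fun z => L (traj n a α u y s, z, s)) (u s), c⟫) =
      ⟪ψ, fderiv ℝ g (y, traj n a α u y b) (η, η + kap a α b • c)⟫ := by
  obtain ⟨hZ, R, hR⟩ := Z_lem hα0 hadm y
  set xb := traj n a α u y b with hxb
  have hκ := kap_pos (a := a) hα0 hab
  let f1 : EE n × EE n →L[ℝ] EE n := ContinuousLinearMap.fst ℝ (EE n) (EE n)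
  let f2 : EE n × EE n →L[ℝ] EE n := ContinuousLinearMap.snd ℝ (EE n) (EE n)
  let M0 : EE n × EE n →L[ℝ] EE n × EE n × ℝ := f1.prod (f2.prod 0)
  let M1 : EE n × EE n →L[ℝ] EE n × EE n × ℝ := f2.prod 0
  let N : EE n × EE n →L[ℝ] EE n × EE n := f1.prod (f1 + kap a α b • f2)
  have hN : ∀ p, N p = (p.1, p.1 + kap a α b • p.2) := fun p => rfl
  have hM : ∀ s p, (M0 + kap a α s • M1) p = (p.1 + kap a α s • p.2, p.2, 0) := by
    intro s p; simp [M0, M1, f1, f2]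
  obtain ⟨h1, h2⟩ := diff_lem (wgt_int hab hβ) hZ hR
    (M := fun s => M0 + kap a α s • M1) (K := ‖M0‖ + kap a α b * ‖M1‖)
    (((kap_meas a α).aestronglyMeasurable.smul_const M1).const_add M0)
    (by positivity) (by
      filter_upwards [ae_restrict_mem measurableSet_Ioc] with s hs
      refine (norm_add_le _ _).trans ?_
      rw [norm_smul, Real.norm_of_nonneg (kap_nonneg hα0 hs.1.le)]
      gcongr
      exact kap_mono hα0 hs.1.le hs.2) hL
  have hN0 : HasStrictFDerivAt (fun p => (y, xb) + N p) N 0 := N.hasStrictFDerivAt.const_add _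
  have e0 : (y, xb) + N 0 = (y, xb) := by simp
  have hG : HasStrictFDerivAt (fun p => g ((y, xb) + N p)) ((fderiv ℝ g (y, xb)).comp N) 0 := by
    have h3 : HasStrictFDerivAt g (fderiv ℝ g (y, xb)) ((y, xb) + N 0) := by
      rw [e0]; exact hg.contDiffAt.hasStrictFDerivAt one_ne_zero
    exact h3.comp 0 hN0
  have hF1 : HasFDerivAt (fun p => φ ((y, xb) + N p)) ((fderiv ℝ φ (y, xb)).comp N) 0 := by
    have h3 : HasFDerivAt φ (fderiv ℝ φ (y, xb)) ((y, xb) + N 0) := by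
      rw [e0]; exact (hφ.differentiable one_ne_zero _).hasFDerivAt
    exact h3.comp 0 hN0.hasFDerivAt
  have hNs : Function.Surjective N := by
    rintro ⟨p, q⟩
    refine ⟨(p, (kap a α b)⁻¹ • (q - p)), ?_⟩
    rw [hN]
    simp [smul_smul, hκ.ne']
  have htr : ∀ η c s, s ∈ Icc a b → traj n a α (fun s => u s + c) (y + η) s =
      traj n a α u y s + (η + kap a α s • c) := by
    intro η c s hs
    rw [traj_eq, traj_eq, frac_add hα0 hadm (adm_const c) hs, frac_const hα0]; abel
  have hval : ∀ p : EE n × EE n, φ ((y, xb) + N p) + ∫ s in Ioc a b, wgt b β s * L ((traj n a α u y s, u s, s) +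
      (M0 + kap a α s • M1) p) = bolza n a b α β φ L (fun s => u s + p.2) (y + p.1) := by
    intro p
    rw [bolza, htr _ _ b ⟨hab.le, le_rfl⟩, intervalIntegral.integral_of_le hab.le]
    congr 1
    refine setIntegral_congr_fun measurableSet_Ioc fun s hs => ?_
    simp only [htr _ _ s ⟨hs.1.le, hs.2⟩, hM]
    simp [wgt]
  obtain ⟨ψ, hψ, hψ2⟩ := mult_lem (hF1.add h2) hG (hsurj.comp hNs) hSconv (by simpa using hgS) (by
    intro p hp
    simp only [Pi.add_apply]
    rw [hval, hval]
    simp only [Prod.snd_zero, Prod.fst_zero, add_zero]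
    refine hmin _ _ (adm_add hadm (adm_const _)) ?_
    rw [htr _ _ b ⟨hab.le, le_rfl⟩]
    exact hp)
  refine ⟨ψ, by simpa using hψ2, fun η c => ?_⟩
  have h5 := hψ (η, c)
  rw [ContinuousLinearMap.add_apply, ContinuousLinearMap.integral_apply h1] at h5
  simp only [ContinuousLinearMap.comp_apply, hN] at h5
  rw [← h5]
  congr 1
  refine setIntegral_congr_fun measurableSet_Ioc fun s hs => ?_
  simp only [ContinuousLinearMap.smul_apply, ContinuousLinearMap.comp_apply, hM]
  simp [gradL (hL.differentiable one_ne_zero), inner_smul_left, mul_add]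

lemma leg_all {n : ℕ} {a b α β : ℝ} (hab : a < b) (hα : 0 < α) (hβ : 0 < β)
    {L : EE n × EE n × ℝ → ℝ} (hL : ContDiff ℝ 2 L) {u : ℝ → EE n} {y : EE n}
    (hu : admissible n a b u)
    (hfix : ∀ u' : ℝ → EE n, admissible n a b u' → traj n a α u' y b = traj n a α u y b →
      ∫ s in Ioc a b, wgt b β s * L (traj n a α u y s, u s, s) ≤
      ∫ s in Ioc a b, wgt b β s * L (traj n a α u' y s, u' s, s)) :
    ∀ᵐ t ∂(volume.restrict (Ioc a b)), ∀ v : EE n,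
      0 ≤ wgt b β t * ⟪v, (fderiv ℝ (fun z => gradient (fun z' => L (traj n a α u y t, z', t)) z) (u t)) v⟫ := by
  have h1 : ∀ᵐ t ∂(volume.restrict (Ioc a b)), ∀ k : ℕ, _ :=
    ae_all_iff.2 fun k => leg_int hab hα hβ hL.continuous hu hfix (TopologicalSpace.denseSeq (EE n) k)
  filter_upwards [h1] with t ht
  refine leg_point hL _ _ _ _ fun v => ?_
  have hLc := hL.continuous
  have hcl : IsClosed {v : EE n | 0 ≤ wgt b β t * (1/2 * (L (traj n a α u y t, u t + v, t) +
      L (traj n a α u y t, u t - v, t)) - L (traj n a α u y t, u t, t))} :=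
    isClosed_le continuous_const (by fun_prop)
  have := (TopologicalSpace.denseRange_denseSeq (EE n)).closure_range
  have h2 : closure (range (TopologicalSpace.denseSeq (EE n))) ⊆ _ :=
    hcl.closure_subset_iff.2 (by rintro _ ⟨k, rfl⟩; exact ht k)
  rw [this] at h2
  exact h2 (mem_univ v)

end PartI

section PartJ

lemma int_bdd {n : ℕ} {a b C : ℝ} {k : ℝ → ℝ} (hk : Measurable k) (hC : ∀ s ∈ Ioc a b, |k s| ≤ C)
    {r : ℝ → EE n} (hr : Integrable r (volume.restrict (Ioc a b))) :
    Integrable (fun s => k s • r s) (volume.restrict (Ioc a b)) :=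
  hr.bdd_smul C hk.aestronglyMeasurable (by
    filter_upwards [ae_restrict_mem measurableSet_Ioc] with s hs
    exact hC s hs)

lemma tail_int {n : ℕ} {a b τ : ℝ} (hτ : τ ∈ Icc a b) {k k2 : ℝ → ℝ} (h1 : ∀ s, τ < s → k s = k2 s)
    (h2 : ∀ s, s ≤ τ → k s = 0) (r : ℝ → EE n) :
    ∫ s in Ioc a b, k s • r s = ∫ s in τ..b, k2 s • r s := by
  rw [intervalIntegral.integral_of_le hτ.2]
  have h3 : ∫ s in Ioc τ b, k s • r s = ∫ s in Ioc τ b, k2 s • r s :=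
    setIntegral_congr_fun measurableSet_Ioc (fun s hs => by simp only [h1 s hs.1])
  rw [← h3]
  refine setIntegral_eq_of_subset_of_forall_sdiff_eq_zero measurableSet_Ioc
    (Ioc_subset_Ioc_left hτ.1) ?_
  rintro s ⟨hs, hs'⟩
  have : s ≤ τ := by
    by_contra h
    exact hs' ⟨not_le.1 h, hs.2⟩
  simp only [h2 s this, zero_smul]

lemma main_id {n : ℕ} {a b α : ℝ} (hab : a < b) (hα0 : 0 < α) (hα1 : α ≤ 1) {r p : ℝ → EE n}
    (hr : Integrable r (volume.restrict (Ioc a b))) (hp : Integrable p (volume.restrict (Ioc a b)))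
    (qb : EE n)
    (hm : ∀ c : EE n, ∫ s in Ioc a b, (⟪r s, kap a α s • c⟫ + ⟪p s, c⟫) = kap a α b * ⟪qb, c⟫)
    (hf : ∀ v : ℝ → EE n, admissible n a b v → frac n a α v b = 0 →
      ∫ s in Ioc a b, (⟪r s, frac n a α v s⟫ + ⟪p s, v s⟫) = 0) (τ : ℝ) (hτ : τ ∈ Icc a b) :
    (∫ s in τ..b, (s - τ) • r s) +
      ∫ s in τ..b, ((s - τ) ^ (1 - α) / Real.Gamma (2 - α)) • p s = (b - τ) • qb := by
  have hκ := kap_pos (a := a) hα0 hab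
  have i1 : Integrable (fun s => (max (s - τ) 0) • r s) (volume.restrict (Ioc a b)) :=
    int_bdd (C := b - a) (by fun_prop) (fun s hs => by
      rw [abs_of_nonneg (le_max_right _ _)]
      exact max_le (by linarith [hs.2, hτ.1]) (by linarith)) hr
  have i2 : Integrable (fun s => rho α τ s • p s) (volume.restrict (Ioc a b)) :=
    int_bdd (C := (b - τ) ^ (1 - α) / Real.Gamma (2 - α)) (rho_meas α τ) (fun s hs => by
      have hG : 0 < Real.Gamma (2 - α) := Real.Gamma_pos_of_pos (by linarith)
      have hb : 0 ≤ b - τ := by linarith [hτ.2]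
      rw [rho]
      split_ifs with h
      · have h0 : 0 ≤ s - τ := by linarith
        rw [abs_of_nonneg (by positivity)]
        have h2 : s ≤ b := hs.2
        have h3 : 0 ≤ 1 - α := by linarith
        gcongr
      · rw [abs_zero]; positivity) hp
  have i3 : Integrable (fun s => kap a α s • r s) (volume.restrict (Ioc a b)) :=
    int_bdd (C := kap a α b) (kap_meas a α) (fun s hs => by
      rw [abs_of_nonneg (kap_nonneg hα0 hs.1.le)]
      exact kap_mono hα0 hs.1.le hs.2) hr
  rw [← tail_int hτ (k := fun s => max (s - τ) 0) (fun s hs => max_eq_left (by linarith))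
    (fun s hs => max_eq_right (by linarith)) r,
    ← tail_int hτ (k := rho α τ) (fun s hs => by simp [rho, hs])
    (fun s hs => by simp [rho, not_lt.2 hs]) p]
  refine ext_inner_right ℝ fun e => ?_
  set c0 : EE n := ((b - τ) / kap a α b) • e with hc0
  have h1 := hf (fun s => rho α τ s • e + (-c0)) (adm_add (rho_adm hα1 τ e) (adm_const _)) (by
    rw [frac_add hα0 (rho_adm hα1 τ e) (adm_const _) ⟨hab.le, le_rfl⟩, frac_const hα0,
      frac_rho hα0 hα1 hτ e ⟨hab.le, le_rfl⟩, hc0, max_eq_left (by linarith [hτ.2])]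
    rw [smul_neg, smul_smul, mul_div_cancel₀ _ hκ.ne', add_neg_cancel])
  have h2 : ∀ s ∈ Ioc a b, (⟪r s, frac n a α (fun s => rho α τ s • e + (-c0)) s⟫ +
      ⟪p s, rho α τ s • e + (-c0)⟫ : ℝ) = (⟪(max (s - τ) 0) • r s, e⟫ + ⟪rho α τ s • p s, e⟫) -
      (⟪r s, kap a α s • c0⟫ + ⟪p s, c0⟫) := by
    intro s hs
    rw [frac_add hα0 (rho_adm hα1 τ e) (adm_const _) ⟨hs.1.le, hs.2⟩, frac_const hα0,
      frac_rho hα0 hα1 hτ e ⟨hs.1.le, hs.2⟩]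
    simp only [inner_add_right, inner_smul_left, inner_smul_right, inner_neg_right, smul_neg]
    simp
    ring
  rw [setIntegral_congr_fun measurableSet_Ioc h2] at h1
  have j1 : Integrable (fun s => (⟪(max (s - τ) 0) • r s, e⟫ : ℝ)) (volume.restrict (Ioc a b)) := i1.inner_const e
  have j2 : Integrable (fun s => (⟪rho α τ s • p s, e⟫ : ℝ)) (volume.restrict (Ioc a b)) := i2.inner_const e
  have j3 : Integrable (fun s => (⟪r s, kap a α s • c0⟫ : ℝ)) (volume.restrict (Ioc a b)) := by
    refine (i3.inner_const c0).congr (Filter.Eventually.of_forall fun s => ?_)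
    simp [inner_smul_left, inner_smul_right]
  have j4 : Integrable (fun s => (⟪p s, c0⟫ : ℝ)) (volume.restrict (Ioc a b)) := hp.inner_const c0
  have h4 := integral_sub (j1.add j2) (j3.add j4)
  simp only [Pi.add_apply] at h4
  rw [h4, hm, integral_add j1 j2] at h1
  have k1 : ∫ s in Ioc a b, (⟪(max (s - τ) 0) • r s, e⟫ : ℝ) = ⟪∫ s in Ioc a b, (max (s - τ) 0) • r s, e⟫ := by
    rw [real_inner_comm, ← integral_inner i1]; simp only [real_inner_comm]
  have k2 : ∫ s in Ioc a b, (⟪rho α τ s • p s, e⟫ : ℝ) = ⟪∫ s in Ioc a b, rho α τ s • p s, e⟫ := by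
    rw [real_inner_comm, ← integral_inner i2]; simp only [real_inner_comm]
  rw [k1, k2, hc0, inner_smul_right, ← mul_assoc, mul_div_cancel₀ _ hκ.ne'] at h1
  rw [inner_add_left, real_inner_smul_left]
  linarith

end PartJ

theorem stmt_19 (n j : ℕ) (hn : 1 ≤ n) (hj : 1 ≤ j) (a b : ℝ) (hab : a < b)
    (α β : ℝ) (hα0 : 0 < α) (hα1 : α ≤ 1) (hβ : 0 < β)
    (φ : EuclideanSpace ℝ (Fin n) × EuclideanSpace ℝ (Fin n) → ℝ)
    (L : EuclideanSpace ℝ (Fin n) × EuclideanSpace ℝ (Fin n) × ℝ → ℝ)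
    (hφ : ContDiff ℝ 2 φ) (hL : ContDiff ℝ 2 L)
    (g : EuclideanSpace ℝ (Fin n) × EuclideanSpace ℝ (Fin n) → EuclideanSpace ℝ (Fin j))
    (hg : ContDiff ℝ 1 g)
    (S : Set (EuclideanSpace ℝ (Fin j)))
    (hSne : S.Nonempty) (hScl : IsClosed S) (hSconv : Convex ℝ S)
    (u : ℝ → EuclideanSpace ℝ (Fin n)) (y : EuclideanSpace ℝ (Fin n))
    (hadm : admissible n a b u)
    (hgS : g (traj n a α u y a, traj n a α u y b) ∈ S)
    (hsurj : Function.Surjective (fderiv ℝ g (traj n a α u y a, traj n a α u y b)))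
    (hmin : ∀ u' : ℝ → EuclideanSpace ℝ (Fin n), ∀ y' : EuclideanSpace ℝ (Fin n),
      admissible n a b u' → g (traj n a α u' y' a, traj n a α u' y' b) ∈ S →
      bolza n a b α β φ L u y ≤ bolza n a b α β φ L u' y') :
    ∃ ψ : EuclideanSpace ℝ (Fin j), ∃ q : ℝ → EuclideanSpace ℝ (Fin n),
      -- (0) -ψ belongs to the normal cone to S at g(x(a),x(b))
      (∀ z ∈ S, (⟪-ψ, z - g (traj n a α u y a, traj n a α u y b)⟫) ≤ 0) ∧
      -- (i) Euler-Lagrange: q is absolutely continuous with the prescribed derivative,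
      -- and coincides a.e. with the right fractional integral of order 1-α of p̃
      IntervalIntegrable (fun s => ((b - s) ^ (β - 1) / Real.Gamma β) •
          gradient (fun z => L (z, u s, s)) (traj n a α u y s)) volume a b ∧
      (∀ t ∈ Icc a b, q t = q a + ∫ s in a..t,
          ((b - s) ^ (β - 1) / Real.Gamma β) •
            gradient (fun z => L (z, u s, s)) (traj n a α u y s)) ∧
      (α < 1 → ∀ᵐ t ∂(volume.restrict (Icc a b)),
          q t = ∫ s in t..b, (((s - t) ^ (-α) / Real.Gamma (1 - α)) *
              ((b - s) ^ (β - 1) / Real.Gamma β)) •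
            gradient (fun z => L (traj n a α u y s, z, s)) (u s)) ∧
      (α = 1 → ∀ᵐ t ∂(volume.restrict (Icc a b)),
          q t = ((b - t) ^ (β - 1) / Real.Gamma β) •
            gradient (fun z => L (traj n a α u y t, z, t)) (u t)) ∧
      -- (ii) transversality conditions
      q a = gradient (fun z => φ (z, traj n a α u y b)) (traj n a α u y a)
        - (ContinuousLinearMap.adjoint
            (fderiv ℝ (fun z => g (z, traj n a α u y b)) (traj n a α u y a))) ψ ∧
      -q b = gradient (fun z => φ (traj n a α u y a, z)) (traj n a α u y b)
        - (ContinuousLinearMap.adjoint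
            (fderiv ℝ (fun z => g (traj n a α u y a, z)) (traj n a α u y b))) ψ ∧
      -- (iii) Legendre condition
      (∀ᵐ t ∂(volume.restrict (Icc a b)), ∀ v : EuclideanSpace ℝ (Fin n),
        0 ≤ ((b - t) ^ (β - 1) / Real.Gamma β) *
          ⟪v, (fderiv ℝ (fun z => gradient (fun z' =>
              L (traj n a α u y t, z', t)) z) (u t)) v⟫) := by
  have hta : ∀ (u' : ℝ → EE n) (y' : EE n), traj n a α u' y' a = y' := by
    intro u' y'; simp [traj]
  simp only [hta] at hgS hsurj hmin ⊢
  have hL1 : ContDiff ℝ 1 L := hL.of_le (by norm_num)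
  have hφ1 : ContDiff ℝ 1 φ := hφ.of_le (by norm_num)
  have hφd : Differentiable ℝ φ := hφ1.differentiable one_ne_zero
  have hgd : Differentiable ℝ g := hg.differentiable one_ne_zero
  have hfix : ∀ u' : ℝ → EE n, admissible n a b u' → traj n a α u' y b = traj n a α u y b →
      ∫ s in Ioc a b, wgt b β s * L (traj n a α u y s, u s, s) ≤
      ∫ s in Ioc a b, wgt b β s * L (traj n a α u' y s, u' s, s) := by
    intro u' hu' he
    have h := hmin u' y hu' (by rw [he]; exact hgS)
    rw [bolza, bolza, he, intervalIntegral.integral_of_le hab.le,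
      intervalIntegral.integral_of_le hab.le] at h
    exact le_of_add_le_add_left h
  obtain ⟨hZ, R, hR⟩ := Z_lem hα0 hadm y
  obtain ⟨hr, hp⟩ := grad_int (wgt_int hab hβ) hL1 hZ hR
  obtain ⟨ψ, hψ1, hψ2⟩ := mult_main hab hα0 hβ hφ1 hL1 hg hSconv hadm hgS hsurj hmin
  have hff := fun (v : ℝ → EE n) (hv : admissible n a b v) (hvb : frac n a α v b = 0) =>
    fix_lem hab hα0 hβ hL1 hadm hfix hv hvb
  have hleg := leg_all hab hα0 hβ hL hadm hfix
  set r : ℝ → EE n := fun s => wgt b β s • gradient (fun z => L (z, u s, s)) (traj n a α u y s) with hrdef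
  set p : ℝ → EE n := fun s => wgt b β s • gradient (fun z => L (traj n a α u y s, z, s)) (u s) with hpdef
  set xb := traj n a α u y b with hxb
  have hri : IntervalIntegrable r volume a b :=
    (intervalIntegrable_iff_integrableOn_Ioc_of_le hab.le).2 hr
  have hpi : IntervalIntegrable p volume a b :=
    (intervalIntegrable_iff_integrableOn_Ioc_of_le hab.le).2 hp
  set qa : EE n := gradient (fun z => φ (z, xb)) y
        - (ContinuousLinearMap.adjoint (fderiv ℝ (fun z => g (z, xb)) y)) ψ with hqa
  set Q2 : EE n := gradient (fun z => φ (y, z)) xb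
        - (ContinuousLinearMap.adjoint (fderiv ℝ (fun z => g (y, z)) xb)) ψ with hQ2
  have hqa1 : ∀ η : EE n, (⟪qa, η⟫ : ℝ) = fderiv ℝ φ (y, xb) (η, 0) - ⟪ψ, fderiv ℝ g (y, xb) (η, 0)⟫ := by
    intro η
    rw [hqa, inner_sub_left, ContinuousLinearMap.adjoint_inner_left, fder1 hgd, inner_gradient_left, fder1 hφd]
  have hQ21 : ∀ η : EE n, (⟪Q2, η⟫ : ℝ) = fderiv ℝ φ (y, xb) (0, η) - ⟪ψ, fderiv ℝ g (y, xb) (0, η)⟫ := by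
    intro η
    rw [hQ2, inner_sub_left, ContinuousLinearMap.adjoint_inner_left, fder2 hgd, inner_gradient_left, fder2 hφd]
  set q : ℝ → EE n := fun t => qa + ∫ s in a..t, r s with hq
  have hqaa : q a = qa := by simp [hq]
  have hqb : -q b = Q2 := by
    have h0 : qa + (∫ s in a..b, r s) + Q2 = 0 := by
      refine ext_inner_right ℝ fun η => ?_
      have h1 := hψ2 η 0
      have h2 : ((η, η) : EE n × EE n) = (η, 0) + (0, η) := by simp
      simp only [smul_zero, add_zero, inner_zero_right] at h1
      rw [h2, map_add, map_add, inner_add_right] at h1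
      have k1 : ∫ s in Ioc a b, (⟪r s, η⟫ : ℝ) = ⟪∫ s in Ioc a b, r s, η⟫ := by
        rw [real_inner_comm, ← integral_inner hr]; simp only [real_inner_comm]
      rw [k1] at h1
      rw [inner_add_left, inner_add_left, hqa1, hQ21, intervalIntegral.integral_of_le hab.le, inner_zero_left]
      linarith
    exact neg_eq_of_add_eq_zero_right h0
  have hm : ∀ c : EE n, ∫ s in Ioc a b, (⟪r s, kap a α s • c⟫ + ⟪p s, c⟫) = kap a α b * ⟪q b, c⟫ := by
    intro c
    have h1 := hψ2 0 c
    simp only [zero_add] at h1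
    have h2 := hQ21 (kap a α b • c)
    rw [← hqb, inner_neg_left, inner_smul_right] at h2
    linarith
  have hEL := EL_lem (α := α) hab hri hpi qa (fun t => rfl) (q := q)
    (main_id hab hα0 hα1 hr hp (q b) hm hff)
  refine ⟨ψ, q, ?_, hri, ?_, ?_, ?_, hqaa, hqb, ?_⟩
  · intro z hz
    rw [inner_neg_left]
    linarith [hψ1 z hz]
  · intro t _
    rw [hqaa]
    rfl
  · intro h
    filter_upwards [hEL.1 h] with t ht
    rw [ht]
    simp only [hpdef, smul_smul]
    rfl
  · intro h
    exact hEL.2 h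
  · rw [← Measure.restrict_congr_set Ioc_ae_eq_Icc]
    exact hleg
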